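/- arXiv:2405.17981 — 4 statements merged into one kernel-verified Lean document; each statement's English description precedes it below -/
import Mathlib

section
/- Let $n\ge 2$ and $m_1,\dots,m_n\ge 1$ be rational integers with $m_1+\cdots+m_n=2s$ even, and for an integer $d\ge 1$ let $T_{\overrightarrow{m}}(d)$ denote the coefficient of $z^{2s}$ in the Taylor expansion at $z=0$ of the analytic function $z\mapsto (dz\cot(dz))\prod_{l=1}^{n} z^{m_l}\cot^{(m_l-1)}(z)$. Then for every integer $d\ge 2$, $$\sum_{k=1}^{d-1}\prod_{l=1}^{n}\cot^{(m_l-1)}(k\pi/d)=-T_{\overrightarrow{m}}(d)+\begin{cases}(-1)^{n/2}\,d&\text{if }m_1=\cdots=m_n=1,\\ 0&\text{otherwise},\end{cases}$$ and moreover the same right-hand side vanishes at $d=1$. -/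
open scoped Classical Real Topology

open Metric in
/-- Integration by parts on a circle. -/
theorem circleIntegral_mul_deriv_eq_neg {u v : ℂ → ℂ} {c : ℂ} {R : ℝ} (hR : 0 ≤ R)
    (hu : AnalyticOnNhd ℂ u (sphere c R)) (hv : AnalyticOnNhd ℂ v (sphere c R)) :
    (∮ z in C(c, R), u z * deriv v z) = -∮ z in C(c, R), deriv u z * v z := by
  have h0 : (∮ z in C(c, R), (deriv u z * v z + u z * deriv v z)) = 0 :=
    circleIntegral.integral_eq_zero_of_hasDerivWithinAt (f := fun z ↦ u z * v z) hR fun z hz ↦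
      ((hu z hz).differentiableAt.hasDerivAt.mul
        (hv z hz).differentiableAt.hasDerivAt).hasDerivWithinAt
  rw [circleIntegral.integral_add
    ((hu.deriv.mul hv).continuousOn.circleIntegrable hR)
    ((hu.mul hv.deriv).continuousOn.circleIntegrable hR)] at h0
  linear_combination h0

open Metric in
/-- Iterated integration by parts on a circle. -/
theorem circleIntegral_mul_iteratedDeriv {u v : ℂ → ℂ} {c : ℂ} {R : ℝ} (hR : 0 ≤ R)
    (hu : AnalyticOnNhd ℂ u (sphere c R)) (hv : AnalyticOnNhd ℂ v (sphere c R)) (j : ℕ) :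
    (∮ z in C(c, R), u z * iteratedDeriv j v z) =
      (-1) ^ j * ∮ z in C(c, R), iteratedDeriv j u z * v z := by
  induction j generalizing v with
  | zero => simp
  | succ j ih =>
    rw [iteratedDeriv_succ', ih hv.deriv, circleIntegral_mul_deriv_eq_neg hR _ hv, iteratedDeriv_succ]
    · ring
    · rw [iteratedDeriv_eq_iterate]
      exact hu.iterated_deriv j

/-- The integral of an even function over a circle centred at the origin vanishes. -/
theorem circleIntegral_eq_zero_of_even {f : ℂ → ℂ} {R : ℝ} (hf : ∀ z, f (-z) = f z) :
    (∮ z in C(0, R), f z) = 0 := by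
  have hshift : ∀ θ : ℝ, circleMap 0 R (θ + π) = -circleMap 0 R θ := by
    intro θ
    simp [circleMap, add_mul, Complex.exp_add, Complex.exp_pi_mul_I]
  set g : ℝ → ℂ := fun θ ↦ deriv (circleMap 0 R) θ • f (circleMap 0 R θ) with hg
  have hgs : ∀ θ, g (θ + π) = -g θ := by
    intro θ
    simp [hg, hshift, hf]
  have hper : Function.Periodic g (2 * π) := by
    intro θ
    rw [two_mul, ← add_assoc, hgs, hgs, neg_neg]
  have h1 : (∫ θ in (0 : ℝ)..2 * π, g (θ + π)) = ∫ θ in (0 : ℝ)..2 * π, g θ := by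
    rw [intervalIntegral.integral_comp_add_right, zero_add, add_comm (2 * π) π,
      hper.intervalIntegral_add_eq π 0, zero_add]
  simp only [hgs, intervalIntegral.integral_neg] at h1
  change (∫ θ in (0 : ℝ)..2 * π, g θ) = 0
  exact self_eq_neg.1 h1.symm

namespace Complex

theorem cot_neg (z : ℂ) : cot (-z) = -cot z := by
  simp [cot, div_neg]

theorem cot_add_pi (z : ℂ) : cot (z + π) = cot z := by
  simp [cot, neg_div_neg_eq, sin_add_pi, cos_add_pi]

theorem analyticAt_cot {z : ℂ} (hz : sin z ≠ 0) : AnalyticAt ℂ cot z :=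
  AnalyticAt.div (by fun_prop) (by fun_prop) hz

theorem hasDerivAt_cot {z : ℂ} (hz : sin z ≠ 0) : HasDerivAt cot (-(1 + cot z ^ 2)) z := by
  convert! (hasDerivAt_cos z).div (hasDerivAt_sin z) hz using 1
  rw [cot]
  field_simp
  ring

theorem iteratedDeriv_cot_neg (j : ℕ) (z : ℂ) :
    iteratedDeriv j cot (-z) = (-1) ^ (j + 1) * iteratedDeriv j cot z := by
  have h := iteratedDeriv_comp_neg j cot z
  simp only [cot_neg] at h
  rw [iteratedDeriv_fun_neg, smul_eq_mul] at h
  have h1 : ((-1 : ℂ) ^ j) * (-1) ^ j = 1 := by rw [← mul_pow]; simp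
  rw [pow_succ]
  linear_combination (-(-1) ^ j) * h - iteratedDeriv j cot (-z) * h1

theorem iteratedDeriv_cot_pi_sub (j : ℕ) (z : ℂ) :
    iteratedDeriv j cot (π - z) = (-1) ^ (j + 1) * iteratedDeriv j cot z := by
  have h := congrFun (iteratedDeriv_comp_add_const j cot π) (-z)
  simp only [cot_add_pi] at h
  rw [← iteratedDeriv_cot_neg, sub_eq_neg_add]
  exact h.symm

theorem tendsto_mul_cot_zero : Filter.Tendsto (fun z ↦ z * cot z) (𝓝[≠] 0) (𝓝 1) := by
  have h := (hasDerivAt_iff_tendsto_slope.1 (hasDerivAt_sin 0)).inv₀ (by simp)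
  have hc : Filter.Tendsto cos (𝓝[≠] 0) (𝓝 (cos 0)) :=
    continuous_cos.continuousAt.tendsto.mono_left nhdsWithin_le_nhds
  have := hc.mul h
  simp only [cos_zero, inv_one, mul_one] at this
  refine this.congr fun z ↦ ?_
  simp [slope_def_field, cot]
  ring

/-- The multiplication formula for the cotangent. -/
theorem mul_cot_mul {d : ℕ} {z : ℂ} (hz : sin (d * z) ≠ 0) :
    d * cot (d * z) = ∑ k ∈ Finset.range d, cot (z + k * π / d) := by
  obtain rfl | hd := d.eq_zero_or_pos
  · simp
  have hdC : (d : ℂ) ≠ 0 := by exact_mod_cast hd.ne'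
  set w := exp (2 * I * z) with hw
  have hwd : exp (2 * I * (d * z)) = w ^ d := by
    rw [hw, ← exp_nat_mul]; ring_nf
  have hne : 1 - w ^ d ≠ 0 := by
    intro h
    apply hz
    rw [← hwd] at h
    have h2 : exp (2 * I * (d * z)) = exp (d * z * I) * exp (d * z * I) := by
      rw [← exp_add]; ring_nf
    have h3 : exp (-(d * z) * I) * exp (d * z * I) = 1 := by
      rw [← exp_add]; simp
    have h4 : (exp (-(d * z) * I) - exp (d * z * I)) * exp (d * z * I) = 0 := by
      rw [sub_mul, h3, ← h2, h]
    rw [sin, (mul_eq_zero.1 h4).resolve_right (exp_ne_zero _)]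
    simp
  set ζ := exp (2 * π * I / d) with hζ
  have hprod := X_pow_sub_C_eq_prod (isPrimitiveRoot_exp d hd.ne') hd (rfl : w ^ d = w ^ d)
  set f : Polynomial ℂ := Polynomial.X ^ d - Polynomial.C (w ^ d) with hf
  have hf1 : f.eval 1 = 1 - w ^ d := by simp [hf]
  have hroots : f.roots = (Finset.range d).val.map fun i ↦ ζ ^ i * w := by
    rw [hprod, ← Polynomial.roots_multiset_prod_X_sub_C ((Finset.range d).val.map fun i ↦ ζ ^ i * w),
      Multiset.map_map]
    rfl
  have hsum := (IsAlgClosed.splits f).eval_derivative_div_eval_of_ne_zero (x := 1)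
    (by rwa [hf1])
  rw [hroots, Multiset.map_map, hf1] at hsum
  have hsum' : (d : ℂ) / (1 - w ^ d) = ∑ k ∈ Finset.range d, 1 / (1 - ζ ^ k * w) := by
    rw [Finset.sum]
    convert! hsum using 2
    simp [hf, -map_pow, Polynomial.derivative_X_pow]
  have hfac : ∀ k ∈ Finset.range d, 1 - ζ ^ k * w ≠ 0 := by
    intro k hk
    have : f.eval 1 ≠ 0 := by rwa [hf1]
    rw [hprod, Polynomial.eval_prod] at this
    simpa using Finset.prod_ne_zero_iff.1 this k hk
  have hterm : ∀ k ∈ Finset.range d,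
      cot (z + k * π / d) = -I * (2 * (1 / (1 - ζ ^ k * w)) - 1) := by
    intro k hk
    have : exp (2 * I * (z + k * π / d)) = ζ ^ k * w := by
      rw [hζ, hw, ← exp_nat_mul, ← exp_add]; congr 1; field_simp; ring
    rw [cot_eq_exp_ratio, this]
    have := hfac k hk
    have hI := I_sq
    field_simp
    rw [hI]
    ring
  rw [Finset.sum_congr rfl hterm, ← Finset.mul_sum, Finset.sum_sub_distrib, ← Finset.mul_sum,
    ← hsum', cot_eq_exp_ratio, hwd]
  have hI := I_sq
  simp
  field_simp
  rw [hI]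
  ring

/-- `cotPoly j` expresses the `(j - 1)`-st derivative of `cot` as a polynomial in `cot`,
with `cotPoly 0 = 1`. -/
noncomputable def cotPoly : ℕ → Polynomial ℂ
  | 0 => 1
  | 1 => Polynomial.X
  | j + 2 => -(1 + Polynomial.X ^ 2) * (cotPoly (j + 1)).derivative

theorem degree_cotPoly (j : ℕ) : (cotPoly j).degree = j := by
  induction j using cotPoly.induct with
  | case1 => simp [cotPoly]
  | case2 => simp [cotPoly]
  | case3 j ih =>
    have h2 : (-(1 + Polynomial.X ^ 2) : Polynomial ℂ).degree = 2 := by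
      rw [Polynomial.degree_neg]; compute_degree!
    rw [cotPoly, Polynomial.degree_mul, h2, Polynomial.degree_derivative]
    · rw [Polynomial.natDegree_eq_of_degree_eq_some ih]
      norm_cast
      omega
    · simp [Polynomial.natDegree_eq_of_degree_eq_some ih]

theorem span_cotPoly : Submodule.span ℂ (Set.range cotPoly) = ⊤ :=
  Polynomial.Sequence.span ⟨cotPoly, degree_cotPoly⟩ fun i ↦
    isUnit_iff_ne_zero.2 (Polynomial.leadingCoeff_ne_zero.2 (Polynomial.Sequence.ne_zero _ i))

theorem iteratedDeriv_cot_eq_eval (j : ℕ) {z : ℂ} (hz : sin z ≠ 0) :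
    iteratedDeriv j cot z = (cotPoly (j + 1)).eval (cot z) := by
  induction j generalizing z with
  | zero => simp [cotPoly]
  | succ j ih =>
    have hev : iteratedDeriv j cot =ᶠ[𝓝 z] fun w ↦ (cotPoly (j + 1)).eval (cot w) := by
      filter_upwards [continuous_sin.continuousAt.eventually_ne hz] with w hw using ih hw
    have hd : HasDerivAt (fun w ↦ (cotPoly (j + 1)).eval (cot w)) _ z :=
      ((cotPoly (j + 1)).hasDerivAt (cot z)).comp z (hasDerivAt_cot hz)
    rw [iteratedDeriv_succ, hev.deriv_eq, hd.deriv, cotPoly]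
    simp
    ring

theorem eval_cotPoly_eq_zero {x : ℂ} (hx : x ^ 2 = -1) {j : ℕ} (hj : 2 ≤ j) :
    (cotPoly j).eval x = 0 := by
  obtain ⟨j, rfl⟩ := Nat.exists_eq_add_of_le' hj
  simp [cotPoly, hx]


theorem sin_add_mul_pi_div_ne_zero {d k : ℕ} (hk : k < d) {z : ℂ} (hz : ‖z‖ < π / d)
    (h : k ≠ 0 ∨ z ≠ 0) : sin (z + k * π / d) ≠ 0 := by
  have hd : 0 < d := by omega
  have hdR : (0 : ℝ) < d := by exact_mod_cast hd
  have hdC : (d : ℂ) ≠ 0 := by exact_mod_cast hd.ne'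
  intro h0
  obtain ⟨j, hj⟩ := sin_eq_zero_iff.1 h0
  have hz' : z = ((j * d - k : ℤ) : ℂ) * ((π / d : ℝ) : ℂ) := by
    push_cast
    field_simp at hj ⊢
    linear_combination hj
  have hpos : (0 : ℝ) < π / d := div_pos Real.pi_pos hdR
  rw [hz', norm_mul, norm_real, norm_intCast, Real.norm_of_nonneg hpos.le] at hz
  have h1 : |((j * d - k : ℤ) : ℝ)| < 1 := by
    by_contra! hle
    nlinarith
  have h2 : (j * d - k : ℤ) = 0 := by
    rw [← Int.abs_lt_one_iff]
    exact_mod_cast h1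
  have h3 : (d : ℤ) ∣ k := ⟨j, by linarith⟩
  have h4 : k = 0 := Nat.eq_zero_of_dvd_of_lt (by exact_mod_cast h3) hk
  rw [h2] at hz'
  simp_all

theorem sin_mul_ne_zero {d : ℕ} {z : ℂ} (hd : 1 ≤ d) (hz : ‖z‖ < π / d) (h : z ≠ 0) :
    sin (d * z) ≠ 0 := by
  have hdR : (0 : ℝ) < d := by exact_mod_cast hd
  have hdC : (d : ℂ) ≠ 0 := by exact_mod_cast hdR.ne'
  have := sin_add_mul_pi_div_ne_zero (d := 1) (k := 0) (z := d * z) one_pos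
    (by rw [norm_mul, norm_natCast, Nat.cast_one, div_one, mul_comm]; exact (lt_div_iff₀ hdR).1 hz)
    (Or.inr (mul_ne_zero hdC h))
  simpa using this

theorem sin_ne_zero_of_norm_lt_pi {z : ℂ} (hz : ‖z‖ < π) (h : z ≠ 0) : sin z ≠ 0 := by
  simpa using sin_mul_ne_zero (d := 1) le_rfl (by simpa using hz) h

theorem analyticOnNhd_cot_sphere {R : ℝ} (hR : 0 < R) (hRπ : R < π) :
    AnalyticOnNhd ℂ cot (Metric.sphere 0 R) := fun z hz ↦ by
  have hz' : ‖z‖ = R := by simpa using hz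
  exact analyticAt_cot (sin_ne_zero_of_norm_lt_pi (hz' ▸ hRπ) (norm_pos_iff.1 (hz' ▸ hR)))

theorem circleIntegral_mul_cot {f : ℂ → ℂ} {R : ℝ} (hR : 0 < R) (hRπ : R < π)
    (hf : AnalyticOnNhd ℂ f (Metric.closedBall 0 R)) :
    (∮ z in C(0, R), f z * cot z) = 2 * π * I * f 0 := by
  have key : ∀ z ∈ Metric.closedBall (0 : ℂ) R \ {0},
      DifferentiableAt ℂ (fun z ↦ f z * (z * cot z)) z := by
    intro z hz
    have hz1 : ‖z‖ ≤ R := by simpa using hz.1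
    exact (hf z hz.1).differentiableAt.mul (differentiableAt_id.mul
      (analyticAt_cot (sin_ne_zero_of_norm_lt_pi (hz1.trans_lt hRπ) hz.2)).differentiableAt)
  have h := circleIntegral_sub_center_inv_smul_of_differentiable_on_off_countable_of_tendsto
    (f := fun z ↦ f z * (z * cot z)) (c := 0) (y := f 0) hR Set.countable_empty
    (fun z hz ↦ (key z hz).continuousAt.continuousWithinAt)
    (fun z hz ↦ key z ⟨Metric.ball_subset_closedBall hz.1.1, hz.1.2⟩)
    (by
      have h1 := (hf 0 (by simp [hR.le])).continuousAt.tendsto.mono_left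
        (nhdsWithin_le_nhds (s := {0}ᶜ))
      simpa using h1.mul tendsto_mul_cot_zero)
  rw [smul_eq_mul] at h
  rw [← h]
  refine circleIntegral.integral_congr hR.le fun z hz ↦ ?_
  have hz' : z ≠ 0 := norm_pos_iff.1 ((mem_sphere_zero_iff_norm.1 hz).symm ▸ hR)
  simp only [sub_zero, smul_eq_mul]
  field_simp

theorem circleIntegral_mul_iteratedDeriv_cot {f : ℂ → ℂ} {R : ℝ} (hR : 0 < R) (hRπ : R < π)
    (hf : AnalyticOnNhd ℂ f (Metric.closedBall 0 R)) (j : ℕ) :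
    (∮ z in C(0, R), f z * iteratedDeriv j cot z) = 2 * π * I * ((-1) ^ j * iteratedDeriv j f 0) := by
  rw [circleIntegral_mul_iteratedDeriv hR.le (hf.mono Metric.sphere_subset_closedBall)
    (analyticOnNhd_cot_sphere hR hRπ), circleIntegral_mul_cot hR hRπ]
  · ring
  · rw [iteratedDeriv_eq_iterate]
    exact hf.iterated_deriv j

theorem circleIntegral_cot_mul_iteratedDeriv_cot {R : ℝ} (hR : 0 < R) (hRπ : R < π) (j : ℕ) :
    (∮ z in C(0, R), cot z * iteratedDeriv j cot z) = 0 := by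
  rcases j.even_or_odd with hj | hj
  · refine circleIntegral_eq_zero_of_even fun z ↦ ?_
    rw [cot_neg, iteratedDeriv_cot_neg, pow_succ, hj.neg_one_pow]
    ring
  · have h := circleIntegral_mul_iteratedDeriv hR.le (analyticOnNhd_cot_sphere hR hRπ)
      (analyticOnNhd_cot_sphere hR hRπ) j
    simp only [hj.neg_one_pow, neg_one_mul, mul_comm (iteratedDeriv j cot _)] at h
    exact self_eq_neg.1 h

/-- The residue sum of `d * cot (d * z) * P (cot z)` over one period. -/
theorem circleIntegral_cot_mul_eval_cot {d : ℕ} (hd : 1 ≤ d) {R : ℝ} (hR : 0 < R) (hRd : R < π / d)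
    (P : Polynomial ℂ) :
    (∮ z in C(0, R), d * cot (d * z) * P.eval (cot z)) =
      2 * π * I * (d * (P.eval I + P.eval (-I)) / 2 -
        ∑ k ∈ Finset.Ico 1 d, P.eval (cot (k * π / d))) := by
  have hdR : (1 : ℝ) ≤ d := by exact_mod_cast hd
  have hdC : (d : ℂ) ≠ 0 := by exact_mod_cast (zero_lt_one.trans_le hdR).ne'
  have hRπ : R < π := hRd.trans_le (div_le_self Real.pi_pos.le hdR)
  have hne : ∀ z ∈ Metric.sphere (0 : ℂ) R, z ≠ 0 := fun z hz ↦
    norm_pos_iff.1 ((mem_sphere_zero_iff_norm.1 hz).symm ▸ hR)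
  have hcot := analyticOnNhd_cot_sphere hR hRπ
  have hshift : ∀ k ∈ Finset.Ico 1 d,
      AnalyticOnNhd ℂ (fun z ↦ cot (z + k * π / d)) (Metric.closedBall 0 R) := by
    intro k hk z hz
    have hk' := Finset.mem_Ico.1 hk
    have hz' : ‖z‖ ≤ R := by simpa using hz
    exact (analyticAt_cot (sin_add_mul_pi_div_ne_zero hk'.2 (hz'.trans_lt hRd)
      (Or.inl (by omega)))).fun_comp (f := fun z : ℂ ↦ z + k * π / d) (by fun_prop)
  have hsum : ∀ z ∈ Metric.sphere (0 : ℂ) R,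
      d * cot (d * z) = cot z + ∑ k ∈ Finset.Ico 1 d, cot (z + k * π / d) := by
    intro z hz
    rw [mul_cot_mul (sin_mul_ne_zero hd ((mem_sphere_zero_iff_norm.1 hz).trans_lt hRd) (hne z hz)),
      Finset.range_eq_Ico, Finset.sum_eq_sum_Ico_succ_bot hd]
    simp
  have hcont : ∀ Q : Polynomial ℂ,
      AnalyticOnNhd ℂ (fun z ↦ Q.eval (cot z)) (Metric.sphere 0 R) := fun Q z hz ↦
    (Polynomial.differentiable Q).analyticAt _ |>.fun_comp (hcot z hz)
  have hsplit : ∀ Q : Polynomial ℂ, (∮ z in C(0, R), d * cot (d * z) * Q.eval (cot z)) =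
      (∮ z in C(0, R), cot z * Q.eval (cot z)) +
        ∑ k ∈ Finset.Ico 1 d, ∮ z in C(0, R), cot (z + k * π / d) * Q.eval (cot z) := by
    intro Q
    have hint : ∀ k ∈ Finset.Ico 1 d,
        AnalyticOnNhd ℂ (fun z ↦ cot (z + k * π / d) * Q.eval (cot z)) (Metric.sphere 0 R) :=
      fun k hk ↦ ((hshift k hk).mono Metric.sphere_subset_closedBall).mul (hcont Q)
    rw [← circleIntegral.integral_fun_sum
        (fun k hk ↦ (hint k hk).continuousOn.circleIntegrable hR.le),
      ← circleIntegral.integral_add ((hcot.mul (hcont Q)).continuousOn.circleIntegrable hR.le)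
        ((continuousOn_finsetSum _ fun k hk ↦ (hint k hk).continuousOn).circleIntegrable hR.le)]
    refine circleIntegral.integral_congr hR.le fun z hz ↦ ?_
    simp only [hsum z hz, add_mul, Finset.sum_mul]
  have hder : ∀ (f : ℂ → ℂ) (j : ℕ), (∮ z in C(0, R), f z * (cotPoly (j + 1)).eval (cot z)) =
      ∮ z in C(0, R), f z * iteratedDeriv j cot z := by
    intro f j
    refine circleIntegral.integral_congr hR.le fun z hz ↦ ?_
    simp only [iteratedDeriv_cot_eq_eval j (sin_ne_zero_of_norm_lt_pi
      ((mem_sphere_zero_iff_norm.1 hz).trans_lt hRπ) (hne z hz))]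
  have hd_cot : AnalyticOnNhd ℂ (fun z ↦ d * cot (d * z)) (Metric.sphere 0 R) := fun z hz ↦
    analyticAt_const.mul ((analyticAt_cot (sin_mul_ne_zero hd
      ((mem_sphere_zero_iff_norm.1 hz).trans_lt hRd) (hne z hz))).fun_comp (by fun_prop))
  have hP : P ∈ Submodule.span ℂ (Set.range cotPoly) := span_cotPoly ▸ Submodule.mem_top
  induction hP using Submodule.span_induction with
  | zero => simp [circleIntegral]
  | add Q₁ Q₂ _ _ h₁ h₂ =>
    simp only [Polynomial.eval_add, mul_add, Finset.sum_add_distrib]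
    rw [circleIntegral.integral_add ((hd_cot.mul (hcont Q₁)).continuousOn.circleIntegrable hR.le)
      ((hd_cot.mul (hcont Q₂)).continuousOn.circleIntegrable hR.le), h₁, h₂]
    ring
  | smul a Q _ h =>
    simp only [Polynomial.eval_smul, smul_eq_mul, mul_left_comm _ a]
    rw [circleIntegral.integral_const_mul, h, ← Finset.mul_sum]
    ring
  | mem Q hQ =>
    obtain ⟨j, rfl⟩ := hQ
    rw [hsplit]
    obtain _ | j := j
    · have h1 := circleIntegral_mul_cot (f := fun _ ↦ 1) hR hRπ analyticOnNhd_const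
      have h2 : ∀ k ∈ Finset.Ico 1 d, (∮ z in C(0, R), cot (z + k * π / d)) = 0 := fun k hk ↦
        (((hshift k hk).differentiableOn.mono
          Metric.closure_ball_subset_closedBall).diffContOnCl).circleIntegral_eq_zero hR.le
      simp only [one_mul] at h1
      simp only [cotPoly, Polynomial.eval_one, mul_one, Finset.sum_congr rfl h2, h1]
      simp [Nat.cast_sub hd]
      ring
    · have h2 : ∀ k ∈ Finset.Ico 1 d,
          (∮ z in C(0, R), cot (z + k * π / d) * (cotPoly (j + 1)).eval (cot z)) =
            2 * π * I * ((-1) ^ j * (cotPoly (j + 1)).eval (cot (k * π / d))) := by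
        intro k hk
        have hk' := Finset.mem_Ico.1 hk
        rw [hder, circleIntegral_mul_iteratedDeriv_cot hR hRπ (hshift k hk),
          iteratedDeriv_comp_add_const, ← iteratedDeriv_cot_eq_eval]
        · simp only [zero_add]
        have := sin_add_mul_pi_div_ne_zero (z := 0) hk'.2 (by simpa using hR.trans hRd)
          (Or.inl (by omega))
        rwa [zero_add] at this
      have hrefl : ∑ k ∈ Finset.Ico 1 d, (cotPoly (j + 1)).eval (cot (k * π / d)) =
          (-1) ^ (j + 1) * ∑ k ∈ Finset.Ico 1 d, (cotPoly (j + 1)).eval (cot (k * π / d)) := by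
        rw [Finset.mul_sum]
        refine Finset.sum_nbij' (fun k ↦ d - k) (fun k ↦ d - k) ?_ ?_ ?_ ?_ ?_
        · intro k hk; simp only [Finset.mem_Ico] at *; omega
        · intro k hk; simp only [Finset.mem_Ico] at *; omega
        · intro k hk; simp only [Finset.mem_Ico] at *; omega
        · intro k hk; simp only [Finset.mem_Ico] at *; omega
        · intro k hk
          have hk' := Finset.mem_Ico.1 hk
          have hs : ∀ l : ℕ, 1 ≤ l → l < d → sin (l * π / d) ≠ 0 := fun l hl hld ↦ by
            have := sin_add_mul_pi_div_ne_zero (z := 0) hld (by simpa using hR.trans hRd)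
              (Or.inl (by omega))
            rwa [zero_add] at this
          rw [← iteratedDeriv_cot_eq_eval j (hs k hk'.1 hk'.2),
            ← iteratedDeriv_cot_eq_eval j (hs (d - k) (by omega) (by omega)),
            ← iteratedDeriv_cot_pi_sub]
          congr 1
          rw [Nat.cast_sub hk'.2.le]
          field_simp
          ring
      rw [Finset.sum_congr rfl h2, hder, circleIntegral_cot_mul_iteratedDeriv_cot hR hRπ,
        ← Finset.mul_sum, ← Finset.mul_sum]
      have hI : (cotPoly (j + 1)).eval I + (cotPoly (j + 1)).eval (-I) = 0 := by
        obtain _ | j := j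
        · simp [cotPoly]
        · rw [eval_cotPoly_eq_zero (by simp) (by omega),
            eval_cotPoly_eq_zero (by simp) (by omega), add_zero]
      rw [hI]
      rw [pow_succ] at hrefl
      linear_combination (2 * π * I) * hrefl

end Complex

open Complex in
/-- The evaluation of the cotangent sum for every `d ≥ 1`. -/
theorem sum_prod_iteratedDeriv_cot_eq (n s : ℕ) (m : Fin n → ℕ) (hm : ∀ l, 1 ≤ m l)
    (hs : ∑ l, m l = 2 * s) (d : ℕ) (hd : 1 ≤ d) (F : ℂ → ℂ) (hF : AnalyticAt ℂ F 0)
    (hFz : ∀ᶠ z in 𝓝[≠] (0 : ℂ), F z = ((d : ℂ) * z * cot ((d : ℂ) * z)) *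
      ∏ l, z ^ (m l) * iteratedDeriv (m l - 1) cot z) :
    ∑ k ∈ Finset.Ico 1 d, ∏ l, iteratedDeriv (m l - 1) cot ((k : ℂ) * (π : ℂ) / (d : ℂ)) =
      -(iteratedDeriv (2 * s) F 0 / (Nat.factorial (2 * s) : ℂ)) +
        (if ∀ l, m l = 1 then (-1) ^ (n / 2) * (d : ℂ) else 0) := by
  have hdR : (1 : ℝ) ≤ d := by exact_mod_cast hd
  have hπd : 0 < π / d := div_pos Real.pi_pos (zero_lt_one.trans_le hdR)
  have hπd' : π / d ≤ π := div_le_self Real.pi_pos.le hdR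
  obtain ⟨r, hr, hball⟩ := Metric.eventually_nhds_iff_ball.1
    (hF.eventually_analyticAt.and (eventually_nhdsWithin_iff.1 hFz))
  set R := min r (π / d) / 2 with hRdef
  have hmin : 0 < min r (π / d) := lt_min hr hπd
  have hR : 0 < R := half_pos hmin
  have hRr : R < r := (half_lt_self hmin).trans_le (min_le_left _ _)
  have hRd : R < π / d := (half_lt_self hmin).trans_le (min_le_right _ _)
  set P : Polynomial ℂ := ∏ l, cotPoly (m l) with hPdef
  have hprod : ∀ z : ℂ, sin z ≠ 0 → ∏ l, iteratedDeriv (m l - 1) cot z = P.eval (cot z) := by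
    intro z hz
    rw [hPdef, Polynomial.eval_prod]
    refine Finset.prod_congr rfl fun l _ ↦ ?_
    rw [iteratedDeriv_cot_eq_eval _ hz, Nat.sub_add_cancel (hm l)]
  have hcauchy := DifferentiableOn.circleIntegral_one_div_sub_center_pow_smul (f := F) (c := 0)
    hR (2 * s) fun z hz ↦
      (hball z (Metric.closedBall_subset_ball hRr hz)).1.differentiableAt.differentiableWithinAt
  have hcongr : (∮ z in C(0, R), (1 / (z - 0) ^ (2 * s + 1)) • F z) =
      ∮ z in C(0, R), d * cot (d * z) * P.eval (cot z) := by
    refine circleIntegral.integral_congr hR.le fun z hz ↦ ?_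
    have hzR : ‖z‖ = R := mem_sphere_zero_iff_norm.1 hz
    have hz0 : z ≠ 0 := norm_pos_iff.1 (hzR ▸ hR)
    have hzF := (hball z (by simpa [hzR] using hRr)).2 hz0
    have hsin := sin_ne_zero_of_norm_lt_pi (hzR.trans_lt (hRd.trans_le hπd')) hz0
    simp only [smul_eq_mul, sub_zero]
    rw [hzF, Finset.prod_mul_distrib, Finset.prod_pow_eq_pow_sum, hs, hprod z hsin]
    field_simp
    ring
  rw [hcongr, circleIntegral_cot_mul_eval_cot hd hR hRd, smul_eq_mul, div_mul_eq_mul_div,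
    mul_div_assoc (2 * π * I : ℂ)] at hcauchy
  have hcoeff := mul_left_cancel₀ two_pi_I_ne_zero hcauchy
  have hsum : ∑ k ∈ Finset.Ico 1 d, ∏ l, iteratedDeriv (m l - 1) cot ((k : ℂ) * π / d) =
      ∑ k ∈ Finset.Ico 1 d, P.eval (cot (k * π / d)) := by
    refine Finset.sum_congr rfl fun k hk ↦ hprod _ ?_
    have hk' := Finset.mem_Ico.1 hk
    have := sin_add_mul_pi_div_ne_zero (z := 0) hk'.2 (by simpa using hπd) (Or.inl (by omega))
    rwa [zero_add] at this
  have hconst : (P.eval I + P.eval (-I)) / 2 = if ∀ l, m l = 1 then (-1) ^ (n / 2) else 0 := by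
    split_ifs with h1
    · have hn : n = 2 * s := by simpa [h1] using hs
      have hPX : P = Polynomial.X ^ n := by simp [hPdef, h1, cotPoly]
      rw [hPX, hn]
      simp [pow_mul]
    · push Not at h1
      obtain ⟨l, hl⟩ := h1
      have hl2 : 2 ≤ m l := by have := hm l; omega
      have hzero : ∀ x : ℂ, x ^ 2 = -1 → P.eval x = 0 := fun x hx ↦ by
        rw [hPdef, Polynomial.eval_prod]
        exact Finset.prod_eq_zero (Finset.mem_univ l) (eval_cotPoly_eq_zero hx hl2)
      simp [hzero I (by simp), hzero (-I) (by simp)]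
  rw [hsum, ← ite_zero_mul, ← hconst]
  linear_combination -hcoeff

/-- **Evaluation of the cotangent sums `S_{→m}(d)` via Taylor coefficients.**
Let `n ≥ 2`, `m₁,…,m_n ≥ 1` with `m₁ + ⋯ + m_n = 2s` even, and for `d ≥ 1` let
`T(d)` be the coefficient of `z^{2s}` in the Taylor expansion at `0` of the
analytic extension of `z ↦ (dz cot(dz)) ∏_l z^{m_l} cot^{(m_l-1)}(z)`
(the hypothesis `hT` says exactly this, the Taylor coefficient being expressed
as `iteratedDeriv (2s) F 0 / (2s)!`).  Then for every `d ≥ 2`,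
`∑_{k=1}^{d-1} ∏_l cot^{(m_l-1)}(kπ/d) = -T(d) + ((-1)^{n/2} d` if all `m_l = 1`,
else `0)`, and the same right-hand side vanishes at `d = 1`. -/
theorem cotangent_sum_eq_taylor_coeff (n s : ℕ) (hn : 2 ≤ n)
    (m : Fin n → ℕ) (hm : ∀ l, 1 ≤ m l) (hs : ∑ l, m l = 2 * s)
    (T : ℕ → ℂ)
    (hT : ∀ d : ℕ, 1 ≤ d → ∃ F : ℂ → ℂ, AnalyticAt ℂ F 0 ∧
        (∀ᶠ z in 𝓝[≠] (0 : ℂ),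
          F z = ((d : ℂ) * z * Complex.cot ((d : ℂ) * z)) *
              ∏ l, z ^ (m l) * iteratedDeriv (m l - 1) Complex.cot z) ∧
        T d = iteratedDeriv (2 * s) F 0 / (Nat.factorial (2 * s) : ℂ)) :
    (∀ d : ℕ, 2 ≤ d →
        ∑ k ∈ Finset.Ico 1 d,
            ∏ l, iteratedDeriv (m l - 1) Complex.cot ((k : ℂ) * (π : ℂ) / (d : ℂ))
          = -T d + (if ∀ l, m l = 1 then (-1) ^ (n / 2) * (d : ℂ) else 0))
      ∧ -T 1 + (if ∀ l, m l = 1 then (-1) ^ (n / 2) * ((1 : ℕ) : ℂ) else 0) = 0 := by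
  refine ⟨fun d hd ↦ ?_, ?_⟩
  · obtain ⟨F, hF, hFz, hTd⟩ := hT d (by omega)
    rw [hTd]
    exact sum_prod_iteratedDeriv_cot_eq n s m hm hs d (by omega) F hF hFz
  · obtain ⟨F, hF, hFz, hTd⟩ := hT 1 le_rfl
    rw [hTd, ← sum_prod_iteratedDeriv_cot_eq n s m hm hs 1 le_rfl F hF hFz]
    simp
end

section
/- Let $n\ge 2$ and $m_1,\dots,m_n\ge 1$ be rational integers with $m_1+\cdots+m_n=2s$ even. Then $M(\overrightarrow{m},f)$ is asymptotic to $\zeta(2s)\,\phi_{2s}(f)$ as the integer $f>2$ goes to infinity, i.e. $M(\overrightarrow{m},f)/(\zeta(2s)\phi_{2s}(f))\to 1$ as $f\to\infty$. -/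
open scoped Classical Real

open Filter Topology HurwitzZeta

/-- The Hurwitz zeta function of the parity of `m`, evaluated at `m`. -/
noncomputable def parityHurwitzZeta (m : ℕ) (x : UnitAddCircle) : ℂ :=
  if Even m then hurwitzZetaEven x m else hurwitzZetaOdd x m

lemma parityHurwitzZeta_neg (m : ℕ) (x : UnitAddCircle) :
    parityHurwitzZeta m (-x) = (-1) ^ m * parityHurwitzZeta m x := by
  unfold parityHurwitzZeta
  split_ifs with h
  · simp [hurwitzZetaEven_neg, h.neg_one_pow]
  · simp [hurwitzZetaOdd_neg, (Nat.not_even_iff_odd.mp h).neg_one_pow]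

lemma HurwitzZeta.norm_two_mul_hurwitzZetaOdd_sub_le_of_one_lt {x s : ℝ} (hx : 0 < x)
    (hx' : x ≤ 1 / 2) (hs : 1 < s) :
    ‖2 * hurwitzZetaOdd x s - ((x ^ (-s) : ℝ) : ℂ)‖ ≤ 2 ^ s := by
  have hs0 : 0 < s := by linarith
  set u : ℕ → ℝ := fun n ↦ (n + x) ^ (-s) with hu
  set v : ℕ → ℝ := fun n ↦ (n + 1 - x) ^ (-s) with hv
  have hpos (n : ℕ) : 0 < (n : ℝ) + 1 - x := by
    have : (0 : ℝ) ≤ n := n.cast_nonneg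
    linarith
  have h : HasSum (fun n ↦ ((u n - v n : ℝ) : ℂ)) (2 * hurwitzZetaOdd x s) := by
    refine ((hasSum_nat_hurwitzZetaOdd_of_mem_Icc (a := x) ⟨hx.le, by linarith⟩ (s := s)
      (by simpa using hs)).mul_left 2).congr_fun fun n ↦ ?_
    rw [hu, hv]
    dsimp only
    have h1 := hpos n
    rw [Complex.ofReal_sub, Complex.ofReal_cpow (by positivity), Complex.ofReal_cpow h1.le]
    push_cast
    rw [Complex.cpow_neg, Complex.cpow_neg]
    ring
  have hsum := Complex.summable_ofReal.mp h.summable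
  rw [h.unique (Complex.hasSum_ofReal.mpr hsum.hasSum), ← Complex.ofReal_sub, Complex.norm_real,
    Real.norm_eq_abs, abs_le]
  have huv (n : ℕ) : v n ≤ u n :=
    Real.rpow_le_rpow_of_nonpos (by positivity) (by linarith) (by linarith)
  have hvu (n : ℕ) : u (n + 1) ≤ v n :=
    Real.rpow_le_rpow_of_nonpos (hpos n) (by push_cast; linarith) (by linarith)
  have hu0 : u 0 = x ^ (-s) := by simp [hu]
  have hv0 : v 0 ≤ 2 ^ s := by
    have : v 0 ≤ (1 / 2 : ℝ) ^ (-s) :=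
      Real.rpow_le_rpow_of_nonpos (by norm_num) (by push_cast; linarith) (by linarith)
    rwa [Real.rpow_neg (by norm_num), one_div, Real.inv_rpow (by norm_num), inv_inv] at this
  constructor
  · have := hsum.le_tsum 0 fun n _ ↦ sub_nonneg.mpr (huv n)
    linarith
  · have key (N : ℕ) : ∑ n ∈ Finset.range N, (u n - v n) + u N ≤ u 0 := by
      induction N with
      | zero => simp
      | succ N ih =>
        rw [Finset.sum_range_succ]
        linarith [hvu N]
    have : ∑' n, (u n - v n) ≤ u 0 :=
      Real.tsum_le_of_sum_range_le (fun n ↦ sub_nonneg.mpr (huv n)) fun N ↦ by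
        have : 0 ≤ u N := by positivity
        linarith [key N]
    have : (0 : ℝ) ≤ 2 ^ s := by positivity
    linarith

lemma HurwitzZeta.norm_two_mul_hurwitzZetaOdd_sub_le {x s : ℝ} (hx : 0 < x)
    (hx' : x ≤ 1 / 2) (hs : 1 ≤ s) :
    ‖2 * hurwitzZetaOdd x s - ((x ^ (-s) : ℝ) : ℂ)‖ ≤ 2 ^ s := by
  have hZ : Continuous fun t : ℝ ↦ hurwitzZetaOdd x t :=
    (differentiable_hurwitzZetaOdd x).continuous.comp Complex.continuous_ofReal
  have hX : Continuous fun t : ℝ ↦ x ^ (-t) :=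
    continuous_const.rpow continuous_neg fun _ ↦ .inl hx.ne'
  have h2 : Continuous fun t : ℝ ↦ (2 : ℝ) ^ t :=
    continuous_const.rpow continuous_id fun _ ↦ .inl two_ne_zero
  have hclosed : IsClosed {t : ℝ | ‖2 * hurwitzZetaOdd x t - ((x ^ (-t) : ℝ) : ℂ)‖ ≤ 2 ^ t} :=
    isClosed_le (((continuous_const.mul hZ).sub (Complex.continuous_ofReal.comp hX)).norm) h2
  have hsub := hclosed.closure_subset_iff.mpr fun t (ht : t ∈ Set.Ioi (1 : ℝ)) ↦
    norm_two_mul_hurwitzZetaOdd_sub_le_of_one_lt hx hx' ht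
  rw [closure_Ioi] at hsub
  exact hsub hs

lemma HurwitzZeta.exists_norm_two_mul_hurwitzZetaEven_sub_le {m : ℕ} (hm : 2 ≤ m) :
    ∃ K : ℝ, ∀ x : ℝ, 0 < x → x ≤ 1 / 2 →
      ‖2 * hurwitzZetaEven x m - ((x ^ m)⁻¹ : ℝ)‖ ≤ K := by
  have hw : Summable fun n : ℕ ↦ (((n + 1 : ℕ) : ℝ) ^ m)⁻¹ :=
    (summable_nat_add_iff 1).mpr (Real.summable_nat_pow_inv.mpr (by omega))
  refine ⟨∑' n : ℕ, (1 + 2 ^ m) * (((n + 1 : ℕ) : ℝ) ^ m)⁻¹, fun x hx hx' ↦ ?_⟩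
  have hpos (n : ℕ) : 0 < (n : ℝ) + 1 - x := by
    have : (0 : ℝ) ≤ n := n.cast_nonneg
    linarith
  set u : ℕ → ℝ := fun n ↦ ((n + x) ^ m)⁻¹ with hu
  set v : ℕ → ℝ := fun n ↦ ((n + 1 - x) ^ m)⁻¹ with hv
  have h : HasSum (fun n ↦ ((u n + v n : ℝ) : ℂ)) (2 * hurwitzZetaEven x m) := by
    refine ((hasSum_nat_hurwitzZetaEven_of_mem_Icc (a := x) ⟨hx.le, by linarith⟩ (s := m)
      (by simp; omega)).mul_left 2).congr_fun fun n ↦ ?_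
    simp only [hu, hv, Complex.cpow_natCast]
    push_cast
    ring
  have huv (n : ℕ) : u (n + 1) + v n ≤ (1 + 2 ^ m) * (((n + 1 : ℕ) : ℝ) ^ m)⁻¹ := by
    rw [add_mul, one_mul]
    refine add_le_add ?_ ?_
    · simp only [hu]
      gcongr
      linarith
    · have h2 : (((n + 1 : ℕ) : ℝ) / 2) ^ m ≤ (n + 1 - x) ^ m := by
        have : (0 : ℝ) ≤ n := n.cast_nonneg
        gcongr
        push_cast
        linarith
      have := inv_anti₀ (by positivity) h2
      rwa [div_pow, inv_div, div_eq_mul_inv] at this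
  have hsum : Summable fun n ↦ u n + v n := Complex.summable_ofReal.mp h.summable
  have hvpos (n : ℕ) : 0 ≤ v n := inv_nonneg.mpr (pow_nonneg (hpos n).le _)
  have hupos (n : ℕ) : 0 ≤ u n := by positivity
  have hsu : Summable u := .of_nonneg_of_le hupos (fun n ↦ by linarith [hvpos n]) hsum
  have hsv : Summable v := .of_nonneg_of_le hvpos (fun n ↦ by linarith [hupos n]) hsum
  have hu0 : u 0 = (x ^ m)⁻¹ := by simp [hu]
  have heq : ∑' n, (u n + v n) - (x ^ m)⁻¹ = ∑' n, (u (n + 1) + v n) := by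
    rw [hsu.tsum_add hsv, hsu.tsum_eq_zero_add, hu0,
      ((summable_nat_add_iff 1).mpr hsu).tsum_add hsv]
    ring
  rw [h.unique (Complex.hasSum_ofReal.mpr hsum.hasSum), ← Complex.ofReal_sub, Complex.norm_real,
    heq, Real.norm_of_nonneg (tsum_nonneg fun n ↦ add_nonneg (hupos _) (hvpos n))]
  exact (((summable_nat_add_iff 1).mpr hsu).add hsv).tsum_le_tsum huv (hw.mul_left _)

lemma exists_norm_two_mul_parityHurwitzZeta_sub_le {m : ℕ} (hm : 1 ≤ m) :
    ∃ K : ℝ, 0 ≤ K ∧ ∀ x : ℝ, x ≠ 0 → |x| ≤ 1 / 2 →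
      ‖2 * parityHurwitzZeta m x - ((x ^ m)⁻¹ : ℝ)‖ ≤ K := by
  obtain ⟨K, hK⟩ : ∃ K : ℝ, ∀ x : ℝ, 0 < x → x ≤ 1 / 2 →
      ‖2 * parityHurwitzZeta m x - ((x ^ m)⁻¹ : ℝ)‖ ≤ K := by
    by_cases h : Even m
    · simp only [parityHurwitzZeta, if_pos h]
      exact exists_norm_two_mul_hurwitzZetaEven_sub_le (by obtain ⟨k, rfl⟩ := h; omega)
    · simp only [parityHurwitzZeta, if_neg h]
      refine ⟨2 ^ m, fun x hx hx' ↦ ?_⟩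
      simpa [Real.rpow_neg hx.le] using
        norm_two_mul_hurwitzZetaOdd_sub_le hx hx' (s := m) (by exact_mod_cast hm)
  refine ⟨K, (norm_nonneg _).trans (hK (1 / 2) (by norm_num) le_rfl), fun x hx hx' ↦ ?_⟩
  rcases hx.lt_or_gt with hneg | hpos
  · rw [abs_of_neg hneg] at hx'
    have := hK (-x) (by linarith) hx'
    have e : (2 * parityHurwitzZeta m ((-x : ℝ) : UnitAddCircle) - (((-x) ^ m)⁻¹ : ℝ) : ℂ)
        = (-1) ^ m * (2 * parityHurwitzZeta m x - ((x ^ m)⁻¹ : ℝ)) := by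
      rw [AddCircle.coe_neg, parityHurwitzZeta_neg, neg_pow x m, mul_inv, ← inv_pow]
      push_cast
      norm_num
      ring
    rwa [e, norm_mul, norm_pow, norm_neg, norm_one, one_pow, one_mul] at this
  · exact hK x hpos (by rwa [abs_of_pos hpos] at hx')

/-- The (symmetrically summed) series of `k⁻ᵐ` over the integers `k` congruent to `b` modulo `f`. -/
noncomputable def residueClassZeta (f : ℕ) [NeZero f] (m : ℕ) (b : ZMod f) : ℂ :=
  2 * ((f : ℂ) ^ m)⁻¹ * parityHurwitzZeta m (ZMod.toAddCircle b)

/-- The function `residueClassZeta` on integer representatives; it makes sense for all `f`. -/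
noncomputable def intResidueZeta (f m : ℕ) (a : ℤ) : ℂ :=
  2 * ((f : ℂ) ^ m)⁻¹ * parityHurwitzZeta m ((a / f : ℝ) : UnitAddCircle)

lemma residueClassZeta_intCast (f : ℕ) [NeZero f] (m : ℕ) (a : ℤ) :
    residueClassZeta f m a = intResidueZeta f m a := by
  rw [residueClassZeta, ZMod.toAddCircle_intCast, intResidueZeta]

section Orthogonality

variable {f : ℕ} [NeZero f]

lemma residueClassZeta_neg (m : ℕ) (b : ZMod f) :
    residueClassZeta f m (-b) = (-1) ^ m * residueClassZeta f m b := by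
  rw [residueClassZeta, map_neg, parityHurwitzZeta_neg, residueClassZeta]
  ring

lemma DirichletCharacter.LFunction_eq_sum_residueClassZeta (χ : DirichletCharacter ℂ f) {m : ℕ}
    (h : χ (-1) = (-1) ^ m) :
    χ.LFunction m = (∑ j, χ j * residueClassZeta f m j) / 2 := by
  have hsum : (∑ j, χ j * residueClassZeta f m j) / 2 =
      (f : ℂ) ^ (-(m : ℂ)) * ∑ j, χ j * parityHurwitzZeta m (ZMod.toAddCircle j) := by
    rw [Finset.sum_div, Finset.mul_sum, Complex.cpow_neg, Complex.cpow_natCast]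
    refine Finset.sum_congr rfl fun j _ ↦ ?_
    rw [residueClassZeta]
    ring
  rw [hsum, LFunction]
  by_cases hm : _root_.Even m
  · have he : χ.Even := by rwa [hm.neg_one_pow] at h
    simp only [parityHurwitzZeta, if_pos hm]
    exact ZMod.LFunction_def_even he.to_fun _
  · have ho : χ.Odd := by rwa [(Nat.not_even_iff_odd.mp hm).neg_one_pow] at h
    simp only [parityHurwitzZeta, if_neg hm]
    exact ZMod.LFunction_def_odd ho.to_fun _

lemma sum_mul_residueClassZeta_eq_zero (χ : DirichletCharacter ℂ f) {m : ℕ}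
    (h : χ (-1) ≠ (-1) ^ m) : ∑ j, χ j * residueClassZeta f m j = 0 := by
  have hsq (c : ℂ) (hc : c = 1 ∨ c = -1) : c * c = 1 := by rcases hc with rfl | rfl <;> norm_num
  have hm := neg_one_pow_eq_or ℂ m
  have hχ : χ (-1) = 1 ∨ χ (-1) = -1 := χ.even_or_odd
  have hprod : χ (-1) * (-1) ^ m = -1 := by
    rcases hm with hm | hm <;> rcases hχ with hχ | hχ <;> simp_all
  have hneg : ∑ j, χ j * residueClassZeta f m j = -∑ j, χ j * residueClassZeta f m j := by
    conv_lhs => rw [← Equiv.sum_comp (Equiv.neg (ZMod f))]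
    rw [← Finset.sum_neg_distrib]
    refine Finset.sum_congr rfl fun j _ ↦ ?_
    rw [Equiv.neg_apply, residueClassZeta_neg, ← neg_one_mul j, map_mul]
    linear_combination (χ j * residueClassZeta f m j) * hprod
  exact self_eq_neg.mp hneg

lemma sum_conj_mul_LFunction (m : ℕ) {b : ZMod f} (hb : IsUnit b) :
    ∑ χ : DirichletCharacter ℂ f with χ (-1) = (-1) ^ m,
      (starRingEnd ℂ) (χ b) * χ.LFunction m = f.totient / 2 * residueClassZeta f m b := by
  have hconj (χ : DirichletCharacter ℂ f) : (starRingEnd ℂ) (χ b) = χ b⁻¹ := by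
    rw [starRingEnd_apply, MulChar.star_apply', MulChar.inv_apply_eq_inv']
    exact inv_eq_of_mul_eq_one_right (by rw [← map_mul, ZMod.mul_inv_of_unit b hb, map_one])
  calc _ = ∑ χ : DirichletCharacter ℂ f with χ (-1) = (-1) ^ m,
      χ b⁻¹ * ((∑ j, χ j * residueClassZeta f m j) / 2) :=
        Finset.sum_congr rfl fun χ hχ ↦ by
          rw [hconj, χ.LFunction_eq_sum_residueClassZeta (Finset.mem_filter.mp hχ).2]
    _ = ∑ χ : DirichletCharacter ℂ f, χ b⁻¹ * ((∑ j, χ j * residueClassZeta f m j) / 2) :=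
        Finset.sum_filter_of_ne fun χ _ hχ ↦ by
          contrapose! hχ
          rw [sum_mul_residueClassZeta_eq_zero χ hχ, zero_div, mul_zero]
    _ = ∑ j, (∑ χ : DirichletCharacter ℂ f, χ b⁻¹ * χ j) * (residueClassZeta f m j / 2) := by
        simp only [Finset.sum_div, Finset.mul_sum, Finset.sum_mul]
        rw [Finset.sum_comm]
        refine Finset.sum_congr rfl fun j _ ↦ Finset.sum_congr rfl fun χ _ ↦ by ring
    _ = _ := by
        simp only [DirichletCharacter.sum_char_inv_mul_char_eq ℂ hb, ite_mul, zero_mul,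
          Finset.sum_ite_eq, Finset.mem_univ, if_true]
        ring

lemma MulChar.prod_apply_of_isUnit {R R' ι : Type*} [CommMonoid R] [CommMonoidWithZero R']
    (s : Finset ι) (χ : ι → MulChar R R') {b : R} (hb : IsUnit b) :
    (∏ i ∈ s, χ i) b = ∏ i ∈ s, χ i b := by
  induction s using Finset.induction_on with
  | empty => simp [MulChar.one_apply hb]
  | insert i s hi ih => rw [Finset.prod_insert hi, Finset.prod_insert hi, MulChar.mul_apply, ih]

lemma mean_value_prod_LFunction_eq_sum {ι : Type*} [Fintype ι] (m : ι → ℕ) (r : ℕ)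
    (h : Even (∑ i, m i + r)) :
    (2 / (f.totient : ℂ)) ^ Fintype.card ι *
      ∑ χ : ι → DirichletCharacter ℂ f with ∀ i, χ i (-1) = (-1) ^ m i,
        (∏ i, (χ i).LFunction (m i)) *
          (starRingEnd ℂ) (DirichletCharacter.LFunction (∏ i, χ i) r) =
    (∑ b : ZMod f with IsUnit b,
      (∏ i, residueClassZeta f (m i) b) * (starRingEnd ℂ) (residueClassZeta f r b)) / 2 := by
  have hφ : (f.totient : ℂ) ≠ 0 := by
    exact_mod_cast (Nat.totient_pos.mpr (NeZero.pos f)).ne'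
  have hpar : ((-1 : ℂ)) ^ ∑ i, m i = (-1) ^ r := by
    rw [Nat.even_add] at h
    by_cases hr : Even r
    · rw [hr.neg_one_pow, (h.mpr hr).neg_one_pow]
    · rw [(Nat.not_even_iff_odd.mp hr).neg_one_pow,
        (Nat.not_even_iff_odd.mp fun h' ↦ hr (h.mp h')).neg_one_pow]
  have hfilter : (Finset.univ.filter
      fun χ : ι → DirichletCharacter ℂ f ↦ ∀ i, χ i (-1) = (-1) ^ m i) =
      Fintype.piFinset fun i ↦ Finset.univ.filter
        fun χ : DirichletCharacter ℂ f ↦ χ (-1) = (-1) ^ m i := by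
    ext χ
    simp
  have hterm (χ : ι → DirichletCharacter ℂ f) (hχ : ∀ i, χ i (-1) = (-1) ^ m i) :
      (∏ i, (χ i).LFunction (m i)) *
          (starRingEnd ℂ) (DirichletCharacter.LFunction (∏ i, χ i) r) =
      ∑ b : ZMod f with IsUnit b, (∏ i, (starRingEnd ℂ) (χ i b) * (χ i).LFunction (m i)) *
        ((starRingEnd ℂ) (residueClassZeta f r b) / 2) := by
    have hprod : (∏ i, χ i) (-1) = (-1) ^ r := by
      rw [MulChar.prod_apply_of_isUnit _ _ isUnit_neg_one, ← hpar, ← Finset.prod_pow_eq_pow_sum]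
      exact Finset.prod_congr rfl fun i _ ↦ hχ i
    rw [DirichletCharacter.LFunction_eq_sum_residueClassZeta _ hprod,
      ← Finset.sum_filter_of_ne (p := fun b ↦ IsUnit b) fun b _ hb ↦ by
        contrapose! hb
        rw [MulChar.map_nonunit _ hb, zero_mul],
      map_div₀, map_sum, Finset.sum_div, Finset.mul_sum]
    refine Finset.sum_congr rfl fun b hb ↦ ?_
    rw [MulChar.prod_apply_of_isUnit _ _ (Finset.mem_filter.mp hb).2, map_mul, map_prod,
      Finset.prod_mul_distrib, map_ofNat]
    ring
  rw [Finset.sum_congr rfl fun χ hχ ↦ hterm χ (Finset.mem_filter.mp hχ).2, Finset.sum_comm,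
    Finset.mul_sum, Finset.sum_div]
  refine Finset.sum_congr rfl fun b hb ↦ ?_
  rw [← Finset.sum_mul, hfilter, ← Finset.prod_univ_sum
    (fun i ↦ Finset.univ.filter fun χ : DirichletCharacter ℂ f ↦ χ (-1) = (-1) ^ m i)
    fun i χ ↦ (starRingEnd ℂ) (χ b) * χ.LFunction (m i),
    Finset.prod_congr rfl fun i _ ↦ sum_conj_mul_LFunction (m i) (Finset.mem_filter.mp hb).2,
    Finset.prod_mul_distrib, Finset.prod_const, Finset.card_univ]
  have : (2 / (f.totient : ℂ)) ^ Fintype.card ι * (f.totient / 2) ^ Fintype.card ι = 1 := by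
    rw [← mul_pow, div_mul_div_cancel₀ hφ, div_self two_ne_zero, one_pow]
  linear_combination (∏ i, residueClassZeta f (m i) b) *
    ((starRingEnd ℂ) (residueClassZeta f r b) / 2) * this

end Orthogonality

lemma exists_norm_intResidueZeta_sub_le {m : ℕ} (hm : 1 ≤ m) :
    ∃ K : ℝ, 0 ≤ K ∧ ∀ (f : ℕ) (a : ℤ), a ≠ 0 → 2 * |a| ≤ f →
      ‖intResidueZeta f m a - ((a : ℂ) ^ m)⁻¹‖ ≤ K * ((f : ℝ) ^ m)⁻¹ := by
  obtain ⟨K, hK0, hK⟩ := exists_norm_two_mul_parityHurwitzZeta_sub_le hm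
  refine ⟨K, hK0, fun f a ha haf ↦ ?_⟩
  have hf : 0 < f := by have := abs_pos.mpr ha; omega
  have hfR : (0 : ℝ) < f := by exact_mod_cast hf
  have hfC : (f : ℂ) ≠ 0 := by exact_mod_cast hf.ne'
  have haR : (2 : ℝ) * |(a : ℝ)| ≤ f := by exact_mod_cast haf
  have h := hK (a / f) (div_ne_zero (by exact_mod_cast ha) hfR.ne') (by
    rw [abs_div, abs_of_pos hfR, div_le_iff₀ hfR]
    linarith)
  have e : intResidueZeta f m a - ((a : ℂ) ^ m)⁻¹ = ((f : ℂ) ^ m)⁻¹ *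
      (2 * parityHurwitzZeta m ((a / f : ℝ) : UnitAddCircle) - ((((a / f : ℝ)) ^ m)⁻¹ : ℝ)) := by
    rw [intResidueZeta]
    push_cast
    rw [div_pow, inv_div]
    field_simp
  rw [e, norm_mul, norm_inv, norm_pow, Complex.norm_natCast, mul_comm]
  gcongr

lemma exists_norm_intResidueZeta_le {m : ℕ} (hm : 1 ≤ m) :
    ∃ K : ℝ, 0 ≤ K ∧ ∀ (f : ℕ) (a : ℤ), a ≠ 0 → 2 * |a| ≤ f →
      ‖intResidueZeta f m a‖ ≤ K * (|(a : ℝ)| ^ m)⁻¹ := by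
  obtain ⟨K, hK0, hK⟩ := exists_norm_intResidueZeta_sub_le hm
  refine ⟨K + 1, by positivity, fun f a ha haf ↦ ?_⟩
  have haR : 0 < |(a : ℝ)| := abs_pos.mpr (by exact_mod_cast ha)
  have hle : |(a : ℝ)| ≤ f := by
    have : (2 : ℝ) * |(a : ℝ)| ≤ f := by exact_mod_cast haf
    linarith
  calc ‖intResidueZeta f m a‖
      ≤ ‖intResidueZeta f m a - ((a : ℂ) ^ m)⁻¹‖ + ‖((a : ℂ) ^ m)⁻¹‖ := by
        simpa using norm_add_le (intResidueZeta f m a - ((a : ℂ) ^ m)⁻¹) ((a : ℂ) ^ m)⁻¹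
    _ ≤ K * ((f : ℝ) ^ m)⁻¹ + (|(a : ℝ)| ^ m)⁻¹ := by
        refine add_le_add (hK f a ha haf) (le_of_eq ?_)
        rw [norm_inv, norm_pow, Complex.norm_intCast]
    _ ≤ K * (|(a : ℝ)| ^ m)⁻¹ + (|(a : ℝ)| ^ m)⁻¹ := by gcongr
    _ = _ := by ring

lemma tendsto_intResidueZeta {m : ℕ} (hm : 1 ≤ m) {a : ℤ} (ha : a ≠ 0) :
    Tendsto (fun f ↦ intResidueZeta f m a) atTop (𝓝 ((a : ℂ) ^ m)⁻¹) := by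
  obtain ⟨K, -, hK⟩ := exists_norm_intResidueZeta_sub_le hm
  rw [tendsto_iff_norm_sub_tendsto_zero]
  have hlim : Tendsto (fun f : ℕ ↦ K * ((f : ℝ) ^ m)⁻¹) atTop (𝓝 0) := by
    simpa using (((tendsto_pow_atTop (by omega : m ≠ 0)).comp
      (tendsto_natCast_atTop_atTop (R := ℝ))).inv_tendsto_atTop).const_mul K
  refine squeeze_zero' (.of_forall fun f ↦ norm_nonneg _) ?_ hlim
  filter_upwards [eventually_ge_atTop (2 * |a|).toNat] with f hf
  exact hK f a ha (by omega)

lemma hasSum_nat_isUnit_pow_inv (f : ℕ) [NeZero f] {k : ℕ} (hk : 2 ≤ k) :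
    HasSum (fun n : ℕ ↦ if IsUnit (n : ZMod f) then ((n : ℂ) ^ k)⁻¹ else 0)
      (riemannZeta k * ∏ p ∈ f.primeFactors, (1 - 1 / (p : ℂ) ^ k)) := by
  have hre : 1 < (k : ℂ).re := by simp; omega
  have hval : riemannZeta k * ∏ p ∈ f.primeFactors, (1 - 1 / (p : ℂ) ^ k) =
      LSeries (fun n ↦ (1 : DirichletCharacter ℂ f) n) k := by
    rw [← DirichletCharacter.LFunction_eq_LSeries _ hre, mul_comm]
    have h1 : (k : ℂ) ≠ 1 := by exact_mod_cast (by omega : k ≠ 1)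
    have := DirichletCharacter.LFunctionTrivChar_eq_mul_riemannZeta (N := f) h1
    simp only [Complex.cpow_neg, Complex.cpow_natCast, ← one_div] at this
    exact this.symm
  rw [hval]
  refine (DirichletCharacter.LSeriesSummable_of_one_lt_re (1 : DirichletCharacter ℂ f)
    hre).LSeriesHasSum.congr_fun fun n ↦ ?_
  rcases eq_or_ne n 0 with rfl | hn
  · simp [show k ≠ 0 by omega]
  · rw [LSeries.term_of_ne_zero hn, Complex.cpow_natCast]
    split_ifs with h
    · rw [MulChar.one_apply h, one_div]
    · rw [MulChar.map_nonunit _ h, zero_div]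

lemma hasSum_int_isUnit_pow_inv (f : ℕ) [NeZero f] {k : ℕ} (hk : 2 ≤ k) (hk' : Even k) :
    HasSum (fun a : ℤ ↦ if IsUnit (a : ZMod f) then ((a : ℂ) ^ k)⁻¹ else 0)
      (2 * (riemannZeta k * ∏ p ∈ f.primeFactors, (1 - 1 / (p : ℂ) ^ k))) := by
  have h := hasSum_nat_isUnit_pow_inv f hk
  have h0 : (if IsUnit ((0 : ℤ) : ZMod f) then (((0 : ℤ) : ℂ) ^ k)⁻¹ else 0) = 0 := by
    simp [show k ≠ 0 by omega]
  have := HasSum.of_nat_of_neg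
    (f := fun a : ℤ ↦ if IsUnit (a : ZMod f) then ((a : ℂ) ^ k)⁻¹ else 0)
    (h.congr_fun fun n ↦ by simp) (h.congr_fun fun n ↦ by simp [hk'.neg_pow])
  rwa [h0, sub_zero, ← two_mul] at this

lemma one_le_norm_riemannZeta_mul_prod (f : ℕ) [NeZero f] {k : ℕ} (hk : 2 ≤ k) :
    1 ≤ ‖riemannZeta k * ∏ p ∈ f.primeFactors, (1 - 1 / (p : ℂ) ^ k)‖ := by
  have h := Complex.hasSum_re (hasSum_nat_isUnit_pow_inv f hk)
  refine le_trans ?_ (Complex.re_le_norm _)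
  have hnonneg (n : ℕ) : 0 ≤ (if IsUnit (n : ZMod f) then ((n : ℂ) ^ k)⁻¹ else 0).re := by
    split_ifs
    · have : ((n : ℂ) ^ k)⁻¹ = (((n : ℝ) ^ k)⁻¹ : ℝ) := by push_cast; rfl
      rw [this, Complex.ofReal_re]
      positivity
    · simp
  simpa using le_hasSum h 1 fun n _ ↦ hnonneg n

section Asymptotics

variable {ι : Type*} [Fintype ι] (m : ι → ℕ) (r : ℕ)

lemma hasSum_int_prod_intResidueZeta (f : ℕ) [NeZero f] :
    HasSum (fun a : ℤ ↦ if IsUnit (a : ZMod f) then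
        if a * 2 ∈ Set.Ioc (-f : ℤ) f then
          (∏ i, intResidueZeta f (m i) a) * (starRingEnd ℂ) (intResidueZeta f r a) else 0
        else 0)
      (∑ b : ZMod f with IsUnit b,
        (∏ i, residueClassZeta f (m i) b) * (starRingEnd ℂ) (residueClassZeta f r b)) := by
  rw [← (ZMod.injective_valMinAbs (n := f)).hasSum_iff, Finset.sum_filter]
  · refine (hasSum_fintype _).congr_fun fun b ↦ ?_
    simp only [Function.comp_apply, ZMod.coe_valMinAbs, b.valMinAbs_mem_Ioc, if_true,
      ← residueClassZeta_intCast]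
  · intro a ha
    have : ¬ a * 2 ∈ Set.Ioc (-f : ℤ) f := fun h ↦
      ha ⟨a, (ZMod.valMinAbs_spec _ _).mpr ⟨rfl, h⟩⟩
    simp [this]

variable {m r}

lemma tendsto_tsum_prod_intResidueZeta_sub {k : ℕ} (hk : 2 ≤ k) (hm : ∀ i, 1 ≤ m i) (hr : 1 ≤ r)
    (h : ∑ i, m i + r = k) :
    Tendsto (fun f : ℕ ↦ ∑' a : ℤ, if IsUnit (a : ZMod f) then
        (if a * 2 ∈ Set.Ioc (-f : ℤ) f then
          (∏ i, intResidueZeta f (m i) a) * (starRingEnd ℂ) (intResidueZeta f r a) else 0)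
          - ((a : ℂ) ^ k)⁻¹
        else 0) atTop (𝓝 0) := by
  choose K hK0 hK using fun i ↦ exists_norm_intResidueZeta_le (hm i)
  obtain ⟨L, hL0, hL⟩ := exists_norm_intResidueZeta_le hr
  have hne {f : ℕ} (hf : 2 ≤ f) {a : ℤ} (ha : IsUnit (a : ZMod f)) : a ≠ 0 := by
    rintro rfl
    have : Fact (1 < f) := ⟨hf⟩
    simp at ha
  have hsum : Summable fun a : ℤ ↦ ((∏ i, K i) * L + 1) * (|(a : ℝ)| ^ k)⁻¹ := by
    refine Summable.mul_left _ (((Real.summable_one_div_int_pow (p := k)).mpr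
      (by omega)).abs.congr fun a ↦ ?_)
    rw [abs_div, abs_one, abs_pow, one_div]
  refine Tendsto.mono_right (tendsto_tsum_of_dominated_convergence (g := fun _ ↦ 0) hsum
    (fun a ↦ ?_) ?_) (by rw [tsum_zero])
  · rcases eq_or_ne a 0 with rfl | ha
    · refine tendsto_const_nhds.congr' ?_
      filter_upwards [eventually_ge_atTop 2] with f hf
      rw [if_neg fun hu ↦ hne hf hu rfl]
    · have hlim : Tendsto (fun f ↦ (∏ i, intResidueZeta f (m i) a) *
          (starRingEnd ℂ) (intResidueZeta f r a) - ((a : ℂ) ^ k)⁻¹) atTop (𝓝 0) := by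
        have h1 := (tendsto_finsetProd Finset.univ fun i _ ↦
          tendsto_intResidueZeta (hm i) ha).mul
          ((Complex.continuous_conj.tendsto _).comp (tendsto_intResidueZeta hr ha))
        have e : (∏ i, ((a : ℂ) ^ m i)⁻¹) * (starRingEnd ℂ) ((a : ℂ) ^ r)⁻¹ =
            ((a : ℂ) ^ k)⁻¹ := by
          rw [Finset.prod_inv_distrib, Finset.prod_pow_eq_pow_sum, map_inv₀, map_pow, map_intCast,
            ← mul_inv, ← pow_add, h]
        rw [e] at h1
        simpa using h1.sub_const ((a : ℂ) ^ k)⁻¹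
      refine squeeze_zero_norm' ?_ (tendsto_zero_iff_norm_tendsto_zero.mp hlim)
      filter_upwards [eventually_gt_atTop (2 * |a|).toNat] with f hf
      have hmem : a * 2 ∈ Set.Ioc (-f : ℤ) f := by
        rw [Set.mem_Ioc]
        grind
      rw [if_pos hmem]
      split_ifs
      · rfl
      · simp
  · filter_upwards [eventually_ge_atTop 2] with f hf a
    have hCnn : 0 ≤ (∏ i, K i) * L := mul_nonneg (Finset.prod_nonneg fun i _ ↦ hK0 i) hL0
    split_ifs with hu hmem
    · have ha := hne hf hu
      have ha2 : 2 * |a| ≤ f := by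
        rw [Set.mem_Ioc] at hmem
        grind
      refine (norm_sub_le _ _).trans ?_
      rw [add_mul, one_mul]
      refine add_le_add ?_ (by rw [norm_inv, norm_pow, Complex.norm_intCast])
      rw [norm_mul, norm_prod, RCLike.norm_conj]
      calc _ ≤ (∏ i, K i * (|(a : ℝ)| ^ m i)⁻¹) * (L * (|(a : ℝ)| ^ r)⁻¹) :=
            mul_le_mul (Finset.prod_le_prod (fun _ _ ↦ norm_nonneg _) fun i _ ↦ hK i f a ha ha2)
              (hL f a ha ha2) (norm_nonneg _)
              (Finset.prod_nonneg fun i _ ↦ mul_nonneg (hK0 i) (by positivity))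
        _ = _ := by
            rw [Finset.prod_mul_distrib, Finset.prod_inv_distrib, Finset.prod_pow_eq_pow_sum, ← h,
              pow_add, mul_inv]
            ring
    · rw [zero_sub, norm_neg, norm_inv, norm_pow, Complex.norm_intCast, add_mul, one_mul]
      exact le_add_of_nonneg_left (by positivity)
    · rw [norm_zero]
      positivity

end Asymptotics

open Filter in
/-- **Asymptotics of the general mean value:** for `n ≥ 2` and `m₁,…,m_n ≥ 1`
with `m₁ + ⋯ + m_n = 2s` even, `M(→m,f) ∼ ζ(2s) φ_{2s}(f)` as the integer
`f > 2` goes to infinity, i.e. `M(→m,f) / (ζ(2s) φ_{2s}(f)) → 1`.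
(The quotient is given the junk value `0` at `f = 0`; this does not affect
the limit along `atTop`.) -/
theorem mean_value_product_L_asymptotic (n s : ℕ) (hn : 2 ≤ n)
    (m : Fin n → ℕ) (hm : ∀ l, 1 ≤ m l) (hs : ∑ l, m l = 2 * s) :
    Tendsto
      (fun f : ℕ =>
        if h : f = 0 then (0 : ℂ)
        else
          haveI : NeZero f := ⟨h⟩
          ((2 / (Nat.totient f : ℂ)) ^ (n - 1) *
              ∑ χ ∈ Finset.univ.filter
                  (fun χ : Fin (n - 1) → DirichletCharacter ℂ f =>
                    ∀ i, χ i (-1) = (-1) ^ m (Fin.castLE (Nat.sub_le n 1) i)),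
                (∏ i, (χ i).LFunction (m (Fin.castLE (Nat.sub_le n 1) i))) *
                  (starRingEnd ℂ)
                    (DirichletCharacter.LFunction (∏ i, χ i) (m ⟨n - 1, by omega⟩))) /
            (riemannZeta (2 * s) *
              ∏ p ∈ f.primeFactors, (1 - 1 / (p : ℂ) ^ (2 * s))))
      atTop (nhds 1) := by
  have hs2 : 2 ≤ 2 * s := by
    have := Finset.single_le_sum (f := m) (fun _ _ ↦ Nat.zero_le _)
      (Finset.mem_univ (⟨0, by omega⟩ : Fin n))
    have := hm ⟨0, by omega⟩
    omega
  have hs' : ∑ i : Fin (n - 1), m (Fin.castLE (Nat.sub_le n 1) i) + m ⟨n - 1, by omega⟩ =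
      2 * s := by
    obtain ⟨k, rfl⟩ : ∃ k, n = k + 1 := ⟨n - 1, by omega⟩
    rw [← hs, Fin.sum_univ_castSucc]
    rfl
  set μ : Fin (n - 1) → ℕ := fun i ↦ m (Fin.castLE (Nat.sub_le n 1) i)
  set l : ℕ := m ⟨n - 1, by omega⟩
  have hlim := tendsto_tsum_prod_intResidueZeta_sub (m := μ) (r := l) hs2 (fun i ↦ hm _) (hm _) hs'
  rw [tendsto_iff_norm_sub_tendsto_zero]
  refine squeeze_zero' (.of_forall fun f ↦ norm_nonneg _) ?_ (tendsto_norm_zero.comp hlim)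
  filter_upwards [eventually_ne_atTop 0] with f hf
  have : NeZero f := ⟨hf⟩
  have hmain := mean_value_prod_LFunction_eq_sum (f := f) μ l
    (hs' ▸ even_two_mul s)
  rw [Fintype.card_fin] at hmain
  have hone := one_le_norm_riemannZeta_mul_prod f hs2
  have hsum := (hasSum_int_prod_intResidueZeta μ l f).sub
    (hasSum_int_isUnit_pow_inv f hs2 (even_two_mul s))
  have hdiff := (hsum.congr_fun fun a ↦ by split_ifs <;> simp :
    HasSum (fun a : ℤ ↦ if IsUnit (a : ZMod f) then
        (if a * 2 ∈ Set.Ioc (-f : ℤ) f then (∏ i, intResidueZeta f (μ i) a) *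
          (starRingEnd ℂ) (intResidueZeta f l a) else 0)
          - ((a : ℂ) ^ (2 * s))⁻¹
        else 0) _).tsum_eq
  rw [dif_neg hf]
  refine le_of_le_of_eq ?_ (congrArg norm (hdiff.symm.trans (tsum_congr fun a ↦ by congr)))
  push_cast at hone ⊢
  set Z := riemannZeta (2 * s) * ∏ p ∈ f.primeFactors, (1 - 1 / (p : ℂ) ^ (2 * s))
  have hZ : Z ≠ 0 := norm_pos_iff.mp (by linarith)
  set S := ∑ b : ZMod f with IsUnit b, (∏ i, residueClassZeta f (μ i) b) *
    (starRingEnd ℂ) (residueClassZeta f l b)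
  suffices key : ∀ w : ℂ, w = S / 2 → ‖w / Z - 1‖ ≤ ‖S - 2 * Z‖ from
    key _ (Eq.trans (by congr!) hmain)
  rintro _ rfl
  rw [div_sub_one hZ, norm_div, show S / 2 - Z = (S - 2 * Z) / 2 by ring, norm_div,
    Complex.norm_ofNat]
  exact (div_le_self (by positivity) hone).trans (half_le_self (norm_nonneg _))
end

section
/- For every rational integer $d\ge 2$ we have $$\sum_{k=1}^{d-1}\cot^2(\pi k/d)\,\cot'(\pi k/d)=-\frac{1}{45}d^4+\frac{1}{9}d^2-\frac{4}{45},$$ where $\cot'$ is the derivative of the cotangent function; equivalently, this quantity equals minus the residue at $z=0$ of $d\cot(dz)\cot^2(z)\cot'(z)$. -/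
open scoped Real

open Polynomial in
/-- The low coefficients of `∏ (1 - r k X)` determine the second and fourth power sums. -/
theorem sum_pow_eq_coeff_prod_one_sub_mul_X {ι R : Type*} [CommRing R] (s : Finset ι)
    (r : ι → R) {P : R[X]} (hP : P = ∏ k ∈ s, (1 - C (r k) * X)) :
    P.coeff 0 = 1 ∧
    ∑ k ∈ s, r k ^ 2 = P.coeff 1 ^ 2 - 2 * P.coeff 2 ∧
    ∑ k ∈ s, r k ^ 4 = P.coeff 1 ^ 4 - 4 * P.coeff 1 ^ 2 * P.coeff 2 + 2 * P.coeff 2 ^ 2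
      + 4 * P.coeff 1 * P.coeff 3 - 4 * P.coeff 4 := by
  classical
  subst hP
  induction s using Finset.induction_on with
  | empty => simp [coeff_one]
  | insert a s ha ih =>
    obtain ⟨h0, h2, h4⟩ := ih
    rw [Finset.prod_insert ha, Finset.sum_insert ha, Finset.sum_insert ha, h2, h4]
    set Q := ∏ k ∈ s, (1 - C (r k) * X)
    have hsucc (n : ℕ) : ((1 - C (r a) * X) * Q).coeff (n + 1)
        = Q.coeff (n + 1) - r a * Q.coeff n := by
      rw [sub_mul, one_mul, mul_assoc, coeff_sub, coeff_C_mul, coeff_X_mul]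
    have hzero : ((1 - C (r a) * X) * Q).coeff 0 = 1 := by
      simp [mul_coeff_zero, h0]
    refine ⟨hzero, ?_, ?_⟩
    · rw [hsucc 0, hsucc 1, h0]
      ring
    · rw [hsucc 0, hsucc 1, hsucc 2, hsucc 3, h0]
      ring

open Polynomial in
theorem IsPrimitiveRoot.pow_sub_pow_eq_prod_range {R : Type*} [CommRing R] [IsDomain R]
    {ζ : R} {n : ℕ} (h : IsPrimitiveRoot ζ n) (hn : 0 < n) (x y : R) :
    x ^ n - y ^ n = ∏ k ∈ Finset.range n, (x - ζ ^ k * y) := by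
  classical
  rw [h.pow_sub_pow_eq_prod_sub_mul x y hn, nthRootsFinset,
    ← Multiset.toFinset_eq h.nthRoots_one_nodup]
  change ((nthRoots n (1 : R)).map _).prod = _
  rw [h.nthRoots_eq (one_pow n), Multiset.map_map]
  simp [Finset.prod]

open Complex in
/-- The Cayley transform of `exp (2 i θ)` is a cotangent. -/
theorem I_mul_one_add_exp_eq_neg_mul_cot (θ : ℂ) (hθ : sin θ ≠ 0) :
    I * (1 + exp (2 * θ * I)) = -((1 - exp (2 * θ * I)) * cot θ) := by
  have hexp : exp (2 * θ * I) = (cos θ + sin θ * I) ^ 2 := by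
    rw [← exp_mul_I, ← exp_nat_mul]
    push_cast
    ring_nf
  rw [hexp, cot_eq_cos_div_sin]
  field_simp
  have hsq := sin_sq_add_cos_sq θ
  linear_combination (cos θ * sin θ ^ 2 + I * sin θ ^ 3) * I_sq +
    (-I * sin θ - cos θ) * hsq

theorem sin_pi_mul_div_ne_zero {d k : ℕ} (hk : k ∈ Finset.Ico 1 d) :
    Real.sin (π * k / d) ≠ 0 := by
  obtain ⟨h1, hkd⟩ := Finset.mem_Ico.mp hk
  have hk0 : (0 : ℝ) < k := by exact_mod_cast h1
  have hd0 : (0 : ℝ) < d := by exact_mod_cast h1.trans hkd.le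
  have hlt : (k : ℝ) < d := by exact_mod_cast hkd
  refine (Real.sin_pos_of_pos_of_lt_pi (by positivity) ?_).ne'
  rw [div_lt_iff₀ hd0]
  exact mul_lt_mul_of_pos_left hlt Real.pi_pos

open Polynomial in
theorem coeff_one_add_C_mul_X_pow {R : Type*} [CommRing R] (a : R) (d n : ℕ) :
    ((1 + C a * X) ^ d).coeff n = d.choose n * a ^ n := by
  have h : (1 + C a * X) ^ d = ((1 + X : R[X]) ^ d).comp (C a * X) := by simp
  rw [h, comp_C_mul_X_coeff, coeff_one_add_X_pow]

open Polynomial Complex in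
theorem exists_C_mul_X_mul_prod_cot (d : ℕ) (hd : 0 < d) :
    ∃ K : ℂ, C K * (X * ∏ k ∈ Finset.Ico 1 d, (1 - C ((Real.cot (π * k / d) : ℝ) : ℂ) * X))
      = (1 + C I * X) ^ d - (1 + C (-I) * X) ^ d := by
  have hζ := (isPrimitiveRoot_exp d hd.ne').map_of_injective (C_injective (R := ℂ))
  set ζ := exp (2 * π * I / d) with hζ_def
  refine ⟨2 * I * ∏ k ∈ Finset.Ico 1 d, (1 - ζ ^ k), ?_⟩
  have hfac : ∀ k ∈ Finset.Ico 1 d, (1 + C I * X) - C ζ ^ k * (1 + C (-I) * X)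
      = C (1 - ζ ^ k) * (1 - C ((Real.cot (π * k / d) : ℝ) : ℂ) * X) := by
    intro k hk
    have hpow : ζ ^ k = exp (2 * ((π * k / d : ℝ) : ℂ) * I) := by
      rw [hζ_def, ← exp_nat_mul]
      push_cast
      ring_nf
    have hcot := I_mul_one_add_exp_eq_neg_mul_cot ((π * k / d : ℝ) : ℂ)
      (by exact_mod_cast sin_pi_mul_div_ne_zero hk)
    rw [← hpow, ← ofReal_cot] at hcot
    have hC := congrArg (C : ℂ → ℂ[X]) hcot
    simp only [map_mul, map_add, map_sub, map_neg, map_one, map_pow] at hC ⊢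
    linear_combination X * hC
  rw [hζ.pow_sub_pow_eq_prod_range hd, Finset.range_eq_Ico,
    Finset.prod_eq_prod_Ico_succ_bot hd, zero_add, Finset.prod_congr rfl hfac,
    Finset.prod_mul_distrib]
  simp only [map_mul, map_prod, map_neg, pow_zero, map_ofNat]
  ring

theorem cast_choose_three (d : ℕ) :
    (6 * d.choose 3 : ℝ) = d * (d - 1) * (d - 2) := by
  rw [Nat.cast_choose_eq_descPochhammer_div]
  simp [descPochhammer_succ_right, Nat.factorial]
  ring

theorem cast_choose_five (d : ℕ) :
    (120 * d.choose 5 : ℝ) = d * (d - 1) * (d - 2) * (d - 3) * (d - 4) := by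
  rw [Nat.cast_choose_eq_descPochhammer_div]
  simp [descPochhammer_succ_right, Nat.factorial]
  ring

open Polynomial in
theorem sum_cot_sq_and_sum_cot_pow_four (d : ℕ) (hd : 0 < d) :
    ∑ k ∈ Finset.Ico 1 d, Real.cot (π * k / d) ^ 2 = ((d : ℝ) - 1) * (d - 2) / 3 ∧
    ∑ k ∈ Finset.Ico 1 d, Real.cot (π * k / d) ^ 4
      = (((d : ℝ) - 1) * (d - 2)) ^ 2 / 18 - (d - 1) * (d - 2) * (d - 3) * (d - 4) / 30 := by
  obtain ⟨K, hK⟩ := exists_C_mul_X_mul_prod_cot d hd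
  obtain ⟨h0, h2, h4⟩ := sum_pow_eq_coeff_prod_one_sub_mul_X (Finset.Ico 1 d)
    (fun k : ℕ => ((Real.cot (π * k / d) : ℝ) : ℂ)) rfl
  set P := ∏ k ∈ Finset.Ico 1 d, (1 - C ((Real.cot (π * k / d) : ℝ) : ℂ) * X)
  have hcoeff (n : ℕ) : K * P.coeff n
      = d.choose (n + 1) * (Complex.I ^ (n + 1) - (-Complex.I) ^ (n + 1)) := by
    have := congrArg (fun p => p.coeff (n + 1)) hK
    simpa only [coeff_C_mul, coeff_X_mul, coeff_sub, coeff_one_add_C_mul_X_pow, ← mul_sub]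
      using this
  have hd0 : (d : ℂ) ≠ 0 := by exact_mod_cast hd.ne'
  have hK' : K = d * (2 * Complex.I) := by
    have := hcoeff 0
    rw [h0] at this
    simp only [zero_add, Nat.choose_one_right, pow_one] at this
    linear_combination this
  have hK0 : K ≠ 0 := by simp [hK', hd0]
  have hc1 : P.coeff 1 = 0 := by
    have := hcoeff 1
    simpa [hK0] using this
  have hchoose3 : (6 * d.choose 3 : ℂ) = d * (d - 1) * (d - 2) := by
    exact_mod_cast congrArg (fun x : ℝ => (x : ℂ)) (cast_choose_three d)
  have hchoose5 : (120 * d.choose 5 : ℂ) = d * (d - 1) * (d - 2) * (d - 3) * (d - 4) := by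
    exact_mod_cast congrArg (fun x : ℝ => (x : ℂ)) (cast_choose_five d)
  have hc2 : P.coeff 2 = -((d - 1) * (d - 2) / 6) := by
    apply mul_left_cancel₀ hK0
    rw [hcoeff 2, hK']
    linear_combination (2 * Complex.I * d.choose 3) * Complex.I_sq - (Complex.I / 3) * hchoose3
  have hc4 : P.coeff 4 = (d - 1) * (d - 2) * (d - 3) * (d - 4) / 120 := by
    apply mul_left_cancel₀ hK0
    rw [hcoeff 4, hK']
    linear_combination (2 * Complex.I * d.choose 5 * (Complex.I ^ 2 - 1)) * Complex.I_sq
      + (Complex.I / 60) * hchoose5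
  rw [hc1, hc2] at h2
  rw [hc1, hc2, hc4] at h4
  constructor
  · apply Complex.ofReal_injective
    push_cast at h2 ⊢
    linear_combination h2
  · apply Complex.ofReal_injective
    push_cast at h4 ⊢
    linear_combination h4

theorem Real.deriv_cot {x : ℝ} (hx : Real.sin x ≠ 0) :
    deriv Real.cot x = -(1 + Real.cot x ^ 2) := by
  have hfun : Real.cot = fun y => Real.cos y / Real.sin y := funext Real.cot_eq_cos_div_sin
  have h := (Real.hasDerivAt_cos x).div (Real.hasDerivAt_sin x) hx
  rw [Real.cot_eq_cos_div_sin, hfun]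
  refine h.deriv.trans ?_
  field_simp
  ring

/-- For every integer `d ≥ 2`,
`∑_{k=1}^{d-1} cot²(πk/d) cot'(πk/d) = -(1/45) d⁴ + (1/9) d² - 4/45`. -/
theorem sum_cot_sq_mul_deriv_cot (d : ℕ) (hd : 2 ≤ d) :
    ∑ k ∈ Finset.Ico 1 d,
        (Real.cot (π * k / d)) ^ 2 * deriv Real.cot (π * k / d)
      = -(1 / 45) * (d : ℝ) ^ 4 + (1 / 9) * (d : ℝ) ^ 2 - 4 / 45 := by
  obtain ⟨h2, h4⟩ := sum_cot_sq_and_sum_cot_pow_four d (by omega)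
  have hterm : ∀ k ∈ Finset.Ico 1 d,
      Real.cot (π * k / d) ^ 2 * deriv Real.cot (π * k / d)
        = -(Real.cot (π * k / d) ^ 2 + Real.cot (π * k / d) ^ 4) := by
    intro k hk
    rw [Real.deriv_cot (sin_pi_mul_div_ne_zero hk)]
    ring
  rw [Finset.sum_congr rfl hterm, Finset.sum_neg_distrib, Finset.sum_add_distrib, h2, h4]
  ring
end

section
/- Let $n\ge 2$ be an even rational integer and $f>2$ a rational integer. Set $$M_n(f)=\left(\frac{2}{\phi(f)}\right)^{n-1}\sum_{\chi_1(-1)=-1}\cdots\sum_{\chi_{n-1}(-1)=-1}L(1,\chi_1)\cdots L(1,\chi_{n-1})\overline{L(1,\chi_1\cdots\chi_{n-1})},$$ the sums being over odd Dirichlet characters modulo $f$. Then $$M_n(f)=\zeta(n)\left(\phi_n(f)+\frac{n!}{B_n}\sum_{k_0=1}^{n/2-1}C_{n,n/2-k_0}\frac{B_{2k_0}}{(2k_0)!}\frac{\phi_{2k_0}(f)}{f^{n-2k_0}}\right)+(-1)^{n/2}\frac{\pi^n\phi_1(f)}{2f^{n-1}},$$ where for $n\ge N\ge 1$, $$C_{n,N}=\sum_{\substack{e_1,\dots,e_N\ge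 0\\ e_1+2e_2+\cdots+Ne_N=N}}\frac{n!}{(n-(e_1+\cdots+e_N))!}\prod_{l=1}^{N}\frac{1}{e_l!}\left(\frac{B_{2l}}{(2l)!}\right)^{e_l}.$$ -/
open scoped Classical Real

/-- The combinatorial constant
`C_{n,N} = ∑_{e₁,…,e_N ≥ 0, e₁+2e₂+⋯+N e_N = N} (n!/(n-(e₁+⋯+e_N))!)
  ∏_{l=1}^N (1/e_l!) (B_{2l}/(2l)!)^{e_l}`.
(Each `e_l` satisfies `e_l ≤ N`, so the tuples are faithfully encoded as
functions `Fin N → Fin (N+1)`.) -/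
noncomputable def bernC (n N : ℕ) : ℚ :=
  ∑ e ∈ Finset.univ.filter
      (fun e : Fin N → Fin (N + 1) => ∑ l, (l.1 + 1) * (e l : ℕ) = N),
    ((Nat.factorial n : ℚ) / (Nat.factorial (n - ∑ l, (e l : ℕ)) : ℚ)) *
      ∏ l, (1 / (Nat.factorial (e l : ℕ) : ℚ)) *
        ((bernoulli (2 * (l.1 + 1)) : ℚ) /
            (Nat.factorial (2 * (l.1 + 1)) : ℚ)) ^ (e l : ℕ)

open Filter Topology in
lemma hurwitzZetaOdd_one {a : ℝ} (ha0 : 0 < a) (ha1 : a < 1) :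
    HurwitzZeta.hurwitzZetaOdd a 1 = π / 2 * Complex.cot (π * a) := by
  set F : ℝ → ℕ → ℂ := fun s n =>
    (1 / (n + a : ℂ) ^ (s : ℂ) - 1 / (n + 1 - a : ℂ) ^ (s : ℂ)) / 2 with hF
  have hreal : ∀ (s : ℝ) (n : ℕ), F s n =
      (((n + a : ℝ) ^ (-s) - (n + 1 - a : ℝ) ^ (-s)) / 2 : ℝ) := by
    intro s n
    have h1 : (0 : ℝ) ≤ n + a := by positivity
    have h2 : (0 : ℝ) ≤ n + 1 - a := by have := n.cast_nonneg (α := ℝ); linarith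
    simp only [hF]
    push_cast [Complex.ofReal_cpow h1, Complex.ofReal_cpow h2]
    rw [Complex.cpow_neg, Complex.cpow_neg, one_div, one_div]
  set bound : ℕ → ℝ := fun n => if n = 0 then a ^ (-2 : ℝ) + (1 - a) ^ (-2 : ℝ) else 2 / (n : ℝ) ^ 2
    with hbound
  have hsum : Summable bound := by
    have h : Summable fun n : ℕ => 2 / (n : ℝ) ^ 2 := by
      simpa [div_eq_mul_inv] using (Real.summable_nat_pow_inv.mpr one_lt_two).mul_left 2
    refine (summable_congr_cofinite ?_).mpr h
    filter_upwards [(Set.finite_singleton 0).compl_mem_cofinite] with n hn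
    have : n ≠ 0 := by simpa using hn
    simp [hbound, this]
  have hle : ∀ s : ℝ, s ∈ Set.Ioo (1 : ℝ) 2 → ∀ n, ‖F s n‖ ≤ bound n := by
    intro s hs n
    rw [hreal, Complex.norm_real, Real.norm_eq_abs, abs_div, abs_two]
    rcases eq_or_ne n 0 with rfl | hn
    · have h1 : a ^ (-s) ≤ a ^ (-2 : ℝ) :=
        Real.rpow_le_rpow_of_exponent_ge ha0 ha1.le (by linarith [hs.2])
      have h2 : (1 - a) ^ (-s) ≤ (1 - a) ^ (-2 : ℝ) :=
        Real.rpow_le_rpow_of_exponent_ge (by linarith) (by linarith) (by linarith [hs.2])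
      have h3 : 0 ≤ a ^ (-s) := by positivity
      have h4 : 0 ≤ (1 - a) ^ (-s) := Real.rpow_nonneg (by linarith) _
      simp only [hbound, if_true, Nat.cast_zero, zero_add]
      have : |a ^ (-s) - (1 - a) ^ (-s)| ≤ a ^ (-2 : ℝ) + (1 - a) ^ (-2 : ℝ) := by
        rw [abs_le]; constructor <;> linarith
      have h5 := abs_nonneg (a ^ (-s) - (1 - a) ^ (-s))
      linarith
    · have hn1 : (1 : ℝ) ≤ n := by exact_mod_cast Nat.one_le_iff_ne_zero.mpr hn
      have hmem : ∀ x : ℝ, (n : ℝ) ≤ x → x ≤ n + 1 →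
          x ^ (-s) ≤ (n : ℝ) ^ (-s) ∧ ((n : ℝ) + 1) ^ (-s) ≤ x ^ (-s) := fun x h1 h2 =>
        ⟨Real.rpow_le_rpow_of_nonpos (by linarith) h1 (by linarith [hs.1]),
          Real.rpow_le_rpow_of_nonpos (by linarith) h2 (by linarith [hs.1])⟩
      obtain ⟨h1, h2⟩ := hmem (n + a) (by linarith) (by linarith)
      obtain ⟨h3, h4⟩ := hmem (n + 1 - a) (by linarith) (by linarith)
      have key : (n : ℝ) ^ (-s) - ((n : ℝ) + 1) ^ (-s) ≤ 2 / (n : ℝ) ^ 2 := by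
        have e : ((n : ℝ) + 1) ^ (-s) = (n : ℝ) ^ (-s) * ((n : ℝ) / (n + 1)) ^ s := by
          rw [Real.div_rpow (by linarith) (by linarith), Real.rpow_neg (by linarith),
            Real.rpow_neg (by linarith)]
          have : (n : ℝ) ^ s ≠ 0 := (Real.rpow_pos_of_pos (by linarith) _).ne'
          field_simp
        have h5 : ((n : ℝ) / (n + 1)) ^ (2 : ℝ) ≤ ((n : ℝ) / (n + 1)) ^ s :=
          Real.rpow_le_rpow_of_exponent_ge (by positivity)
            ((div_le_one (by linarith)).mpr (by linarith)) hs.2.le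
        have h6 : (n : ℝ) ^ (-s) ≤ (n : ℝ) ^ (-1 : ℝ) :=
          Real.rpow_le_rpow_of_exponent_le hn1 (by linarith [hs.1])
        have h7 : (0 : ℝ) ≤ (n : ℝ) ^ (-s) := by positivity
        rw [Real.rpow_two] at h5
        rw [Real.rpow_neg_one] at h6
        have h8 : 1 - ((n : ℝ) / (n + 1)) ^ 2 ≤ 2 / n := by
          rw [div_pow, ← sub_nonneg]
          have : 2 / (n : ℝ) - (1 - (n : ℝ) ^ 2 / (n + 1) ^ 2) = (3 * n + 2) / (n * (n + 1) ^ 2) := by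
            field_simp
            ring
          rw [this]; positivity
        have h9 : (0 : ℝ) ≤ 2 / n := by positivity
        calc (n : ℝ) ^ (-s) - ((n : ℝ) + 1) ^ (-s)
            = (n : ℝ) ^ (-s) * (1 - ((n : ℝ) / (n + 1)) ^ s) := by rw [e]; ring
          _ ≤ (n : ℝ) ^ (-s) * (2 / n) := by gcongr; linarith
          _ ≤ (n : ℝ)⁻¹ * (2 / n) := by gcongr
          _ = 2 / (n : ℝ) ^ 2 := by field_simp
      simp only [hbound, hn, if_false]
      have h5 : |((n : ℝ) + a) ^ (-s) - ((n : ℝ) + 1 - a) ^ (-s)| ≤ 2 / (n : ℝ) ^ 2 := by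
        rw [abs_le]; constructor <;> linarith
      have h6 := abs_nonneg (((n : ℝ) + a) ^ (-s) - ((n : ℝ) + 1 - a) ^ (-s))
      linarith
  have hne1 : ∀ n : ℕ, ((n : ℂ) + a) ≠ 0 := by
    intro n; exact_mod_cast (by positivity : (n : ℝ) + a ≠ 0)
  have hne2 : ∀ n : ℕ, ((n : ℂ) + 1 - a) ≠ 0 := by
    intro n
    have : (n : ℝ) + 1 - a ≠ 0 := by have := n.cast_nonneg (α := ℝ); linarith
    exact_mod_cast this
  have hpt : ∀ n, Tendsto (fun s => F s n) (𝓝[>] 1) (𝓝 (F 1 n)) := by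
    intro n
    have : ContinuousAt (fun s : ℝ => F s n) 1 := by
      simp only [hreal]
      refine Complex.continuous_ofReal.continuousAt.comp ?_
      have h1 : (n : ℝ) + a ≠ 0 := by exact_mod_cast hne1 n
      have h2 : (n : ℝ) + 1 - a ≠ 0 := by exact_mod_cast hne2 n
      exact ((ContinuousAt.rpow continuousAt_const continuousAt_neg (Or.inl h1)).sub
        (ContinuousAt.rpow continuousAt_const continuousAt_neg (Or.inl h2))).div_const 2
    exact this.tendsto.mono_left nhdsWithin_le_nhds
  have hev : ∀ᶠ s : ℝ in 𝓝[>] (1 : ℝ), s ∈ Set.Ioo (1 : ℝ) 2 :=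
    Ioo_mem_nhdsGT one_lt_two
  have hlim := tendsto_tsum_of_dominated_convergence hsum hpt
    (hev.mono fun s hs n => hle s hs n)
  have hlim' : Tendsto (fun s : ℝ => HurwitzZeta.hurwitzZetaOdd a (s : ℂ)) (𝓝[>] 1)
      (𝓝 (HurwitzZeta.hurwitzZetaOdd a 1)) := by
    have h := ((HurwitzZeta.differentiable_hurwitzZetaOdd (a : UnitAddCircle)).continuous.comp
      Complex.continuous_ofReal).tendsto 1
    simpa using! h.mono_left nhdsWithin_le_nhds
  have heq : ∀ᶠ s : ℝ in 𝓝[>] (1 : ℝ), ∑' n, F s n = HurwitzZeta.hurwitzZetaOdd a (s : ℂ) := by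
    filter_upwards [hev] with s hs
    exact (HurwitzZeta.hasSum_nat_hurwitzZetaOdd_of_mem_Icc ⟨ha0.le, ha1.le⟩
      (by simpa using hs.1)).tsum_eq
  have hval := tendsto_nhds_unique (hlim.congr' heq) hlim'
  rw [← hval]
  have hF1 : ∀ n, F 1 n = (1 / (n + a : ℂ) - 1 / (n + 1 - a : ℂ)) / 2 := by
    intro n; simp [hF]
  have hs1 : Summable (F 1) := by
    refine Summable.of_norm_bounded hsum fun n => ?_
    exact le_of_tendsto ((hpt n).norm) (hev.mono fun s hs => hle s hs n)
  have haZ : (a : ℂ) ∈ Complex.integerComplement := by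
    rintro ⟨k, hk⟩
    have hk' : (k : ℝ) = a := by exact_mod_cast hk
    have h1 : (0 : ℝ) < k := hk' ▸ ha0
    have h2 : (k : ℝ) < 1 := hk' ▸ ha1
    have h3 : 0 < k := by exact_mod_cast h1
    have h4 : k < 1 := by exact_mod_cast h2
    omega
  have hcot := cot_series_rep' haZ
  have hT1 := hs1.hasSum.tendsto_sum_nat
  have hT2 : Tendsto (fun K : ℕ => ∑ n ∈ Finset.range K,
      (1 / ((a : ℂ) - (n + 1)) + 1 / (a + (n + 1)))) atTop (𝓝 (π * Complex.cot (π * a) - 1 / a)) := by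
    rw [hcot]
    have hsm : Summable fun n : ℕ => (1 / ((a : ℂ) - (n + 1)) + 1 / (a + (n + 1))) :=
      summable_cotTerm haZ
    exact hsm.hasSum.tendsto_sum_nat
  have hpart : ∀ K : ℕ, ∑ n ∈ Finset.range K, F 1 n = (1 / a + ∑ n ∈ Finset.range K,
      (1 / ((a : ℂ) - (n + 1)) + 1 / (a + (n + 1))) - 1 / (K + a)) / 2 := by
    intro K
    induction K with
    | zero => simp
    | succ K ih =>
      rw [Finset.sum_range_succ, Finset.sum_range_succ, ih, hF1]
      have e : (1 : ℂ) / (a - (K + 1)) = - (1 / (K + 1 - a)) := by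
        rw [← neg_sub, div_neg]
      rw [e]
      push_cast
      rw [show (a : ℂ) + (K + 1) = K + 1 + a by ring]
      ring
  have h0 : Tendsto (fun K : ℕ => 1 / ((K : ℂ) + a)) atTop (𝓝 0) := by
    have : Tendsto (fun K : ℕ => 1 / ((K : ℝ) + a)) atTop (𝓝 0) :=
      tendsto_const_nhds.div_atTop (tendsto_atTop_add_const_right _ _ tendsto_natCast_atTop_atTop)
    have h := (Complex.continuous_ofReal.tendsto 0).comp this
    simpa [Function.comp_def] using! h
  have hT3 := (((hT2.const_add (1 / (a : ℂ))).sub h0).div_const 2).congr fun K => (hpart K).symm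
  rw [tendsto_nhds_unique hT1 hT3]
  ring

lemma ZMod_LFunction_one_of_odd {N : ℕ} [NeZero N] {Φ : ZMod N → ℂ} (hΦ : Φ.Odd) :
    ZMod.LFunction Φ 1 = Complex.I * π / (2 * N) *
      ∑ j, Φ j * ((ZMod.stdAddChar j + 1) / (ZMod.stdAddChar j - 1)) := by
  rw [ZMod.LFunction_def_odd hΦ, Complex.cpow_neg_one, Finset.mul_sum, Finset.mul_sum]
  refine Finset.sum_congr rfl fun j _ => ?_
  have hN : (0 : ℝ) < N := by exact_mod_cast NeZero.pos N
  rcases eq_or_ne j 0 with rfl | hj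
  · have : Φ 0 = 0 := hΦ.map_zero
    simp [this]
  have hv0 : (0 : ℝ) < j.val := by
    exact_mod_cast Nat.pos_of_ne_zero (by simpa [ZMod.val_eq_zero] using hj)
  have hv1 : (j.val : ℝ) < N := by exact_mod_cast ZMod.val_lt j
  rw [ZMod.toAddCircle_apply, hurwitzZetaOdd_one (by positivity) ((div_lt_one hN).mpr hv1),
    Complex.cot_pi_eq_exp_ratio]
  have hs : ZMod.stdAddChar j = Complex.exp (2 * π * Complex.I * ((j.val / N : ℝ) : ℂ)) := by
    have := ZMod.stdAddChar_coe (N := N) (j.val : ℤ)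
    simp only [Int.cast_natCast, ZMod.natCast_zmod_val] at this
    rw [this]
    congr 1
    push_cast
    ring
  rw [← hs]
  have hne : ZMod.stdAddChar j - 1 ≠ (0 : ℂ) := by
    rw [sub_ne_zero]
    intro h
    exact hj (ZMod.injective_stdAddChar (by simpa using h))
  have hne' : 1 - ZMod.stdAddChar j ≠ (0 : ℂ) := by rwa [← neg_sub, neg_ne_zero]
  have hNc : (N : ℂ) ≠ 0 := NeZero.ne _
  rw [show (1 : ℂ) - ZMod.stdAddChar j = -(ZMod.stdAddChar j - 1) by ring]
  field_simp
  rw [Complex.I_sq]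
  ring

open PowerSeries in
lemma coeff_derivative_mul_pow_mul_pow {T V : PowerSeries ℂ} (hTV : T * V = X)
    (hT : constantCoeff T = 0) {n k : ℕ} (hk : k ≤ n) :
    coeff n (derivative ℂ T * V ^ (n + 1) * T ^ k) = if k = n then 1 else 0 := by
  obtain ⟨j, rfl⟩ := Nat.exists_eq_add_of_le hk
  have hder : derivative ℂ T * V + T * derivative ℂ V = 1 := by
    have := congrArg (derivative ℂ) hTV
    simp only [Derivation.leibniz, smul_eq_mul, derivative_X] at this
    rw [← this]; ring
  have h1 : derivative ℂ T * V ^ (k + j + 1) * T ^ k = X ^ k * (derivative ℂ T * V ^ (j + 1)) := by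
    rw [← hTV]; ring
  rw [h1, add_comm k j, coeff_X_pow_mul]
  rcases j with _ | j
  · have : derivative ℂ T * V ^ (0 + 1) = 1 - T * derivative ℂ V := by rw [← hder]; ring
    rw [this]
    simp [hT]
  · have h2 : derivative ℂ T * V ^ (j + 1 + 1) =
        V ^ (j + 1) - X * (V ^ j * derivative ℂ V) := by
      rw [← hTV]
      linear_combination V ^ (j + 1) * hder
    have h3 : derivative ℂ (V ^ (j + 1)) = C ((j : ℂ) + 1) * (V ^ j * derivative ℂ V) := by
      rw [Derivation.leibniz_pow]
      simp [nsmul_eq_mul, smul_eq_mul]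
    have h4 := congrArg (coeff j) h3
    rw [coeff_C_mul, coeff_derivative] at h4
    have hj : (j : ℂ) + 1 ≠ 0 := by exact_mod_cast Nat.succ_ne_zero j
    have h5 : coeff j (V ^ j * derivative ℂ V) = coeff (j + 1) (V ^ (j + 1)) := by
      apply mul_left_cancel₀ hj
      rw [← h4]; ring
    rw [h2, map_sub, coeff_succ_X_mul, h5, sub_self, if_neg (by omega)]

open PowerSeries in
lemma coeff_derivative_mul_pow_mul_geom {T V G : PowerSeries ℂ} (hTV : T * V = X)
    (hT : constantCoeff T = 0) {y : ℂ} (hG : G * (1 - C y * T) = 1) (n : ℕ) :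
    coeff n (derivative ℂ T * V ^ (n + 1) * G) = y ^ n := by
  have h1 : G = ∑ k ∈ Finset.range (n + 1), C (y ^ k) * T ^ k + (C y * T) ^ (n + 1) * G := by
    have h := geom_sum_mul_neg (C y * T) (n + 1)
    have h2 : ∑ k ∈ Finset.range (n + 1), C (y ^ k) * T ^ k
        = ∑ k ∈ Finset.range (n + 1), (C y * T) ^ k :=
      Finset.sum_congr rfl fun k _ => by rw [mul_pow, map_pow]
    rw [h2]
    linear_combination -G * h + (∑ k ∈ Finset.range (n + 1), (C y * T) ^ k) * hG
  have h2 : derivative ℂ T * V ^ (n + 1) * ((C y * T) ^ (n + 1) * G) =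
      X ^ (n + 1) * (derivative ℂ T * C y ^ (n + 1) * G) := by
    rw [← hTV]; ring
  rw [h1, mul_add, map_add, h2, coeff_X_pow_mul', if_neg (by omega), add_zero, Finset.mul_sum,
    map_sum]
  have h3 : ∀ k ∈ Finset.range (n + 1),
      coeff n (derivative ℂ T * V ^ (n + 1) * (C (y ^ k) * T ^ k)) = if k = n then y ^ n else 0 := by
    intro k hk
    rw [mul_left_comm, coeff_C_mul, coeff_derivative_mul_pow_mul_pow hTV hT
      (Nat.lt_succ_iff.mp (Finset.mem_range.mp hk))]
    split_ifs with h
    · rw [h, mul_one]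
    · rw [mul_zero]
  rw [Finset.sum_congr rfl h3]
  simp

lemma sum_stdAddChar_pow {m : ℕ} [NeZero m] (k : ℕ) :
    ∑ j : ZMod m, (ZMod.stdAddChar j : ℂ) ^ k = if m ∣ k then (m : ℂ) else 0 := by
  have h := AddChar.sum_mulShift (R := ZMod m) (R' := ℂ) (k : ZMod m)
    (ZMod.isPrimitive_stdAddChar m)
  rw [ZMod.card] at h
  simp only [ZMod.natCast_eq_zero_iff] at h
  convert h using 2 with j
  · rw [← AddChar.map_nsmul_eq_pow, nsmul_eq_mul, mul_comm]
  · split_ifs <;> simp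

/-- The power series `(X / 2) coth (X / 2)`, that is `∑ B_{2j} X^{2j} / (2j)!`. -/
noncomputable def cothSeries : PowerSeries ℂ :=
  bernoulliPowerSeries ℂ + PowerSeries.C (1 / 2) * PowerSeries.X

open PowerSeries in
lemma cothSeries_mul_exp_sub_one :
    2 * cothSeries * (exp ℂ - 1) = X * (exp ℂ + 1) := by
  have h := bernoulliPowerSeries_mul_exp_sub_one ℂ
  have h2 : (2 : PowerSeries ℂ) * C (1 / 2) = 1 := by
    rw [← map_ofNat (C (R := ℂ)) 2, ← map_mul]; norm_num
  rw [cothSeries]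
  linear_combination 2 * h + X * (exp ℂ - 1) * h2

open PowerSeries in
lemma rescale_cothSeries_mul (m : ℕ) :
    2 * rescale (m : ℂ) cothSeries * (exp ℂ ^ m - 1) = C (m : ℂ) * X * (exp ℂ ^ m + 1) := by
  have h := congrArg (rescale (m : ℂ)) cothSeries_mul_exp_sub_one
  simp only [map_mul, map_sub, map_add, map_one, map_ofNat, rescale_X] at h
  rwa [← exp_pow_eq_rescale_exp] at h

lemma coeff_cothSeries_even (j : ℕ) : PowerSeries.coeff (2 * j) cothSeries =
    (bernoulli (2 * j) : ℂ) / ((2 * j).factorial : ℂ) := by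
  rw [cothSeries, map_add, PowerSeries.coeff_C_mul, PowerSeries.coeff_X, if_neg (by omega),
    bernoulliPowerSeries, PowerSeries.coeff_mk]
  simp

lemma coeff_cothSeries_odd (j : ℕ) : PowerSeries.coeff (2 * j + 1) cothSeries = 0 := by
  rw [cothSeries, map_add, PowerSeries.coeff_C_mul, PowerSeries.coeff_X,
    bernoulliPowerSeries, PowerSeries.coeff_mk]
  rcases j with _ | j
  · norm_num [bernoulli_one]
  · rw [bernoulli_eq_zero_of_odd ⟨j + 1, rfl⟩ (by omega), if_neg (by omega)]
    simp

open PowerSeries in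
lemma sum_stdAddChar_ratio_pow {m n : ℕ} [NeZero m] (hn : Even n) (hn0 : n ≠ 0) :
    ∑ j : ZMod m, (((ZMod.stdAddChar j : ℂ) + 1) / (ZMod.stdAddChar j - 1)) ^ n =
      m - 2 ^ n * coeff n (cothSeries ^ n * rescale (m : ℂ) cothSeries) := by
  set E : PowerSeries ℂ := exp ℂ with hE
  set V : PowerSeries ℂ := 2 * cothSeries with hV
  have hc2 : (2 : PowerSeries ℂ) = C 2 := (map_ofNat (C (R := ℂ)) 2).symm
  have hV0 : constantCoeff V ≠ 0 := by
    have h := coeff_cothSeries_even 0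
    rw [mul_zero, coeff_zero_eq_constantCoeff_apply] at h
    rw [hV, map_mul, h, hc2]
    simp
  set T : PowerSeries ℂ := X * V⁻¹ with hT
  have hTV : T * V = X := by rw [hT, mul_assoc, PowerSeries.inv_mul_cancel _ hV0, mul_one]
  have hT0 : constantCoeff T = 0 := by simp [hT]
  have hVne : V ≠ 0 := fun h => hV0 (by rw [h, map_zero])
  have hVE : V * (E - 1) = X * (E + 1) := cothSeries_mul_exp_sub_one
  have hTE : T * (E + 1) = E - 1 := by
    apply mul_left_cancel₀ hVne
    linear_combination (E + 1) * hTV - hVE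
  have hEder : derivative ℂ E = E := by
    ext k
    rw [coeff_derivative, hE, coeff_exp, coeff_exp, Nat.factorial_succ]
    have : (k : ℂ) + 1 ≠ 0 := by exact_mod_cast Nat.succ_ne_zero k
    have : (k.factorial : ℂ) ≠ 0 := by exact_mod_cast k.factorial_ne_zero
    push_cast
    simp
    field_simp
  have hdT : derivative ℂ T * (E + 1) ^ 2 = 2 * E := by
    have h := congrArg (derivative ℂ) hTE
    simp only [Derivation.leibniz, smul_eq_mul, map_add, map_sub, hEder, Derivation.map_one_eq_zero]
      at h
    linear_combination (E + 1) * h - E * hTE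
  set ω : ZMod m → ℂ := fun j => ZMod.stdAddChar j with hω
  set y : ZMod m → ℂ := fun j => (ω j + 1) / (ω j - 1) with hy
  set G : ZMod m → PowerSeries ℂ := fun j => if j = 0 then 0 else (1 - C (y j) * T)⁻¹ with hGdef
  have hω1 : ∀ j, j ≠ 0 → ω j - 1 ≠ 0 := by
    intro j hj h
    rw [sub_eq_zero] at h
    exact hj (ZMod.injective_stdAddChar (by simpa [hω] using h))
  have hinv : ∀ z : ℂ, (1 - C z * T)⁻¹ * (1 - C z * T) = 1 := fun z =>
    PowerSeries.inv_mul_cancel _ (by simp [hT0])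
  have hGcoeff : ∀ j, coeff n (derivative ℂ T * V ^ (n + 1) * G j) = y j ^ n := by
    intro j
    rcases eq_or_ne j 0 with rfl | hj
    · simp [hGdef, hy, hω, hn0]
    · simp only [hGdef, hj, if_false]
      exact coeff_derivative_mul_pow_mul_geom hTV hT0 (hinv _) n
  have hGE : ∀ j, (E - C (ω j)) * ((E + 1) * derivative ℂ T * G j) = - E * C (ω j - 1) := by
    intro j
    rcases eq_or_ne j 0 with rfl | hj
    · simp [hGdef, hω]
    · simp only [hGdef, hj, if_false]
      have hyω : C (y j) * C (ω j - 1) = C (ω j) + 1 := by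
        rw [← map_mul, hy]
        simp only [div_mul_cancel₀ _ (hω1 j hj)]
        simp
      have hsub : C (ω j - 1) = C (ω j) - 1 := by simp
      have h1 : (1 - C (y j) * T) * (E + 1) * C (ω j - 1) = 2 * (C (ω j) - E) := by
        have : (1 - C (y j) * T) * (E + 1) * C (ω j - 1)
            = (E + 1) * C (ω j - 1) - (C (y j) * C (ω j - 1)) * (T * (E + 1)) := by ring
        rw [this, hyω, hTE, hsub]; ring
      have h2ne : (2 : PowerSeries ℂ) ≠ 0 := by
        rw [hc2, Ne, map_eq_zero_iff _ C_injective]; norm_num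
      apply mul_left_cancel₀ h2ne
      linear_combination ((E + 1) * derivative ℂ T * (1 - C (y j) * T)⁻¹) * h1
        - (derivative ℂ T * (E + 1) ^ 2 * C (ω j - 1)) * hinv (y j) - C (ω j - 1) * hdT
  have hωm : ∀ j, C (ω j) ^ m = (1 : PowerSeries ℂ) := by
    intro j
    rw [← map_pow, hω]
    simp only
    rw [← AddChar.map_nsmul_eq_pow, nsmul_eq_mul]
    simp
  have hmpos : 0 < m := NeZero.pos m
  have hsumG : (E + 1) * (E ^ m - 1) * ∑ j, derivative ℂ T * G j = C (m : ℂ) * (E ^ m - E) := by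
    have h1 : ∀ j, (E + 1) * (E ^ m - 1) * (derivative ℂ T * G j) =
        -E * ∑ i ∈ Finset.range m, E ^ i * C (ω j ^ (m - i) - ω j ^ (m - 1 - i)) := by
      intro j
      have h2 := geom_sum₂_mul E (C (ω j)) m
      rw [hωm] at h2
      rw [← h2]
      have h3 : ∑ i ∈ Finset.range m, E ^ i * C (ω j ^ (m - i) - ω j ^ (m - 1 - i)) =
          (∑ i ∈ Finset.range m, E ^ i * C (ω j) ^ (m - 1 - i)) * C (ω j - 1) := by
        rw [Finset.sum_mul]
        refine Finset.sum_congr rfl fun i hi => ?_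
        have : m - i = m - 1 - i + 1 := by have := Finset.mem_range.mp hi; omega
        rw [this, mul_assoc]
        congr 1
        simp only [map_sub, map_pow, map_one]
        ring
      rw [h3]
      linear_combination (∑ i ∈ Finset.range m, E ^ i * C (ω j) ^ (m - 1 - i)) * hGE j
    rw [Finset.mul_sum, Finset.sum_congr rfl fun j _ => h1 j, ← Finset.mul_sum, Finset.sum_comm]
    have h4 : ∀ i ∈ Finset.range m, ∑ j, E ^ i * C (ω j ^ (m - i) - ω j ^ (m - 1 - i)) =
        (if i = 0 then C (m : ℂ) else 0) - (if i = m - 1 then C (m : ℂ) * E ^ (m - 1) else 0) := by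
      intro i hi
      have hi := Finset.mem_range.mp hi
      rw [← Finset.mul_sum, ← map_sum, Finset.sum_sub_distrib, sum_stdAddChar_pow,
        sum_stdAddChar_pow]
      have e1 : m ∣ m - i ↔ i = 0 := by
        constructor
        · intro h
          by_contra h0
          have := Nat.le_of_dvd (by omega) h
          omega
        · rintro rfl; simp
      have e2 : m ∣ m - 1 - i ↔ i = m - 1 := by
        constructor
        · intro h
          by_contra h0
          have := Nat.le_of_dvd (by omega) h
          omega
        · rintro rfl; simp
      simp only [e1, e2, map_sub, mul_sub]
      congr 1
      · split_ifs with h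
        · rw [h]; simp
        · simp
      · split_ifs with h
        · rw [h, mul_comm]
        · simp
    rw [Finset.sum_congr rfl h4, Finset.sum_sub_distrib, Finset.sum_ite_eq', Finset.sum_ite_eq',
      if_pos (Finset.mem_range.mpr hmpos), if_pos (Finset.mem_range.mpr (by omega))]
    have : E ^ m = E * E ^ (m - 1) := by rw [← pow_succ', Nat.sub_add_cancel hmpos]
    rw [this]; ring
  have hKm := rescale_cothSeries_mul m
  rw [← hE] at hKm
  set Km := rescale (m : ℂ) cothSeries with hKmdef
  have hEm : ∀ k : ℕ, k ≠ 0 → E ^ k - 1 ≠ 0 := by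
    intro k hk h
    have := congrArg (coeff 1) h
    rw [hE, exp_pow_eq_rescale_exp, map_sub, coeff_rescale, coeff_exp, coeff_one] at this
    simp [hk] at this
  have hmain : 2 * (V * ∑ j, derivative ℂ T * G j) = C (m : ℂ) * V - 2 * Km := by
    have hne1 : E - 1 ≠ 0 := by simpa using hEm 1 one_ne_zero
    have hne2 := hEm m hmpos.ne'
    apply mul_left_cancel₀ (mul_ne_zero hne1 hne2)
    linear_combination 2 * (E ^ m - 1) * (∑ j, derivative ℂ T * G j) * hVE + 2 * X * hsumG
      - C (m : ℂ) * (E ^ m - 1) * hVE + (E - 1) * hKm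
  have hVn : coeff n (V ^ (n + 1)) = 2 := by
    have hp := coeff_derivative_mul_pow_mul_geom hTV hT0 (hinv 1) n
    have hm := coeff_derivative_mul_pow_mul_geom hTV hT0 (hinv (-1)) n
    have hp' := hinv 1
    have hm' := hinv (-1)
    set P := (1 - C (1 : ℂ) * T)⁻¹
    set Q := (1 - C (-1 : ℂ) * T)⁻¹
    have hE1 : (E + 1) ^ 2 ≠ 0 := by
      have : constantCoeff ((E + 1) ^ 2) ≠ 0 := by
        simp [hE]
      exact fun h => this (by rw [h, map_zero])
    have h1 : derivative ℂ T * (P + Q) = 1 := by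
      simp only [map_one, map_neg, one_mul, neg_mul, sub_neg_eq_add] at hp' hm'
      have hP : P * 2 = E + 1 := by
        linear_combination (E + 1) * hp' + P * hTE
      have hQ : Q * (2 * E) = E + 1 := by
        linear_combination (E + 1) * hm' - Q * hTE
      apply mul_left_cancel₀ hE1
      linear_combination (P + Q) * hdT + E * hP + hQ
    have h2 : V ^ (n + 1) = derivative ℂ T * V ^ (n + 1) * P + derivative ℂ T * V ^ (n + 1) * Q := by
      linear_combination - V ^ (n + 1) * h1
    rw [h2, map_add, hp, hm, hn.neg_one_pow]
    norm_num
  have hfin : ∑ j, y j ^ n = coeff n (V ^ n * (V * ∑ j, derivative ℂ T * G j)) := by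
    rw [Finset.sum_congr rfl fun j _ => (hGcoeff j).symm, ← map_sum]
    congr 1
    rw [Finset.mul_sum, Finset.mul_sum]
    exact Finset.sum_congr rfl fun j _ => by ring
  have hfin2 : 2 * ∑ j, y j ^ n = m * 2 - 2 * (2 ^ n * coeff n (cothSeries ^ n * Km)) := by
    rw [hfin, ← coeff_C_mul, ← hc2, mul_left_comm, hmain, ← hVn]
    have : V ^ n * (C (m : ℂ) * V - 2 * Km) =
        C (m : ℂ) * V ^ (n + 1) - C (2 * 2 ^ n) * (cothSeries ^ n * Km) := by
      rw [map_mul, map_pow, ← hc2, hV]; ring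
    rw [this, map_sub, coeff_C_mul, coeff_C_mul, hVn]
    ring
  linear_combination hfin2 / 2

lemma bernC_eq_sum_multinomial {n N : ℕ} (hN : N ≤ n) :
    bernC n N = ∑ k ∈ (Finset.univ : Finset (Fin (N + 1))).piAntidiag n with
        ∑ l, l.1 * k l = N,
      (Nat.multinomial Finset.univ k : ℚ) *
        ∏ l : Fin (N + 1), ((bernoulli (2 * l.1) : ℚ) / ((2 * l.1).factorial : ℚ)) ^ k l := by
  have hsum : ∀ e : Fin N → ℕ, ∑ l, (l.1 + 1) * e l = N → ∑ l, e l ≤ N := fun e he =>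
    (Finset.sum_le_sum fun l _ => Nat.le_mul_of_pos_left (e l) (Nat.succ_pos l.1)).trans he.le
  rw [bernC]
  refine Finset.sum_bij'
    (fun e _ => (Fin.cons (n - ∑ l, (e l : ℕ)) (fun l => (e l : ℕ)) : Fin (N + 1) → ℕ))
    (fun k _ l => Fin.ofNat (N + 1) (k l.succ)) ?_ ?_ ?_ ?_ ?_
  · intro e he
    have he := (Finset.mem_filter.mp he).2
    have hle := hsum (fun l => (e l : ℕ)) he
    simp only [Finset.mem_filter, Finset.mem_piAntidiag, Fin.sum_univ_succ, Fin.cons_zero,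
      Fin.cons_succ, Fin.val_zero, zero_mul, zero_add, Fin.val_succ]
    exact ⟨⟨by omega, by simp⟩, he⟩
  · intro k hk
    simp only [Finset.mem_filter, Fin.sum_univ_succ, Fin.val_zero, zero_mul, zero_add,
      Fin.val_succ] at hk
    have hlt : ∀ l : Fin N, k l.succ % (N + 1) = k l.succ := fun l =>
      Nat.mod_eq_of_lt (Nat.lt_succ_of_le ((Finset.single_le_sum (f := fun l : Fin N => k l.succ)
        (fun _ _ => Nat.zero_le _) (Finset.mem_univ l)).trans (hsum (fun l => k l.succ) hk.2)))
    simp only [Finset.mem_filter, Finset.mem_univ, true_and, Fin.val_ofNat, hlt]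
    exact hk.2
  · intro e he
    funext l
    simp
  · intro k hk
    simp only [Finset.mem_filter, Finset.mem_piAntidiag, Fin.sum_univ_succ, Fin.val_zero, zero_mul,
      zero_add, Fin.val_succ] at hk
    have hlt : ∀ l : Fin N, k l.succ % (N + 1) = k l.succ := fun l =>
      Nat.mod_eq_of_lt (Nat.lt_succ_of_le ((Finset.single_le_sum (f := fun l : Fin N => k l.succ)
        (fun _ _ => Nat.zero_le _) (Finset.mem_univ l)).trans (hsum (fun l => k l.succ) hk.2)))
    funext l
    refine Fin.cases ?_ (fun l => ?_) l
    · simp only [Fin.cons_zero, Fin.val_ofNat, hlt]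
      have := hk.1.1
      omega
    · simp only [Fin.cons_succ, Fin.val_ofNat, hlt]
  · intro e he
    have he := (Finset.mem_filter.mp he).2
    have hle := hsum (fun l => (e l : ℕ)) he
    have hspec := Nat.multinomial_spec Finset.univ
      (Fin.cons (n - ∑ l, (e l : ℕ)) (fun l => (e l : ℕ)) : Fin (N + 1) → ℕ)
    simp only [Fin.sum_univ_succ, Fin.prod_univ_succ, Fin.cons_zero, Fin.cons_succ] at hspec
    rw [Nat.sub_add_cancel (hle.trans hN)] at hspec
    rw [Fin.prod_univ_succ]
    simp only [Fin.cons_zero, Fin.cons_succ, Fin.val_zero, mul_zero, bernoulli_zero,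
      Nat.factorial_zero, Nat.cast_one, div_one, one_pow, one_mul, Fin.val_succ]
    rw [Finset.prod_mul_distrib, ← mul_assoc]
    congr 1
    have h0 : ((n - ∑ l, (e l : ℕ)).factorial : ℚ) ≠ 0 := by exact_mod_cast Nat.factorial_ne_zero _
    have h1 : (∏ l, ((e l : ℕ).factorial : ℚ)) ≠ 0 :=
      Finset.prod_ne_zero_iff.mpr fun l _ => by exact_mod_cast Nat.factorial_ne_zero _
    rw [← hspec]
    simp only [one_div, Finset.prod_inv_distrib]
    push_cast
    field_simp

open PowerSeries in
lemma coeff_cothSeries_pow {n N : ℕ} (hN : N ≤ n) :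
    coeff (2 * N) (cothSeries ^ n) = (bernC n N : ℂ) := by
  set q : ℕ → ℂ := fun l => (bernoulli (2 * l) : ℂ) / ((2 * l).factorial : ℂ) with hq
  set P : PowerSeries ℂ := ∑ l : Fin (N + 1), C (q l.1) * X ^ (2 * l.1) with hP
  have hdvd : X ^ (2 * N + 1) ∣ cothSeries - P := by
    rw [X_pow_dvd_iff]
    intro i hi
    rw [map_sub, hP, Fin.sum_univ_eq_sum_range (fun l => C (q l) * X ^ (2 * l) : ℕ → PowerSeries ℂ),
      map_sum]
    simp only [coeff_C_mul, coeff_X_pow]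
    obtain ⟨j, rfl | rfl⟩ := i.even_or_odd'
    · rw [coeff_cothSeries_even, Finset.sum_eq_single j]
      · simp [hq]
      · intro l _ hl
        rw [if_neg (by omega), mul_zero]
      · intro hj
        exact absurd (Finset.mem_range.mpr (by omega)) hj
    · rw [coeff_cothSeries_odd, Finset.sum_eq_zero, sub_zero]
      intro l _
      rw [if_neg (by omega), mul_zero]
  have hcoeff : coeff (2 * N) (cothSeries ^ n) = coeff (2 * N) (P ^ n) := by
    have h := X_pow_dvd_iff.mp (hdvd.trans (sub_dvd_pow_sub_pow cothSeries P n)) (2 * N) (by omega)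
    rwa [map_sub, sub_eq_zero] at h
  rw [hcoeff, bernC_eq_sum_multinomial hN, hP, Finset.sum_pow_eq_sum_piAntidiag, map_sum,
    Finset.sum_filter, Rat.cast_sum]
  refine Finset.sum_congr rfl fun k _ => ?_
  have h1 : ∏ l : Fin (N + 1), (C (q l.1) * X ^ (2 * l.1)) ^ k l =
      C (∏ l : Fin (N + 1), q l.1 ^ k l) * X ^ (2 * ∑ l, l.1 * k l) := by
    simp only [mul_pow, Finset.prod_mul_distrib, map_prod, map_pow, ← pow_mul]
    rw [Finset.prod_pow_eq_pow_sum, Finset.mul_sum]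
    simp only [mul_assoc]
  rw [h1, ← map_natCast (C (R := ℂ)), coeff_C_mul, coeff_C_mul, coeff_X_pow]
  have h2 : 2 * N = 2 * ∑ l, l.1 * k l ↔ ∑ l, l.1 * k l = N := by omega
  simp only [h2]
  split_ifs with h
  · simp [hq]
  · simp

lemma isPrimitiveRoot_stdAddChar {m : ℕ} [NeZero m] {j : ZMod m} (hj : IsUnit j) :
    IsPrimitiveRoot (ZMod.stdAddChar j : ℂ) m := by
  have h1 : IsPrimitiveRoot (ZMod.stdAddChar (1 : ZMod m) : ℂ) m := by
    have h := ZMod.stdAddChar_coe (N := m) 1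
    simp only [Int.cast_one, mul_one] at h
    rw [h]
    exact Complex.isPrimitiveRoot_exp m (NeZero.ne m)
  have hcop : j.val.Coprime m := by
    rw [← ZMod.isUnit_iff_coprime, ZMod.natCast_zmod_val]
    exact hj
  have h2 := h1.pow_of_coprime _ hcop
  rwa [← AddChar.map_nsmul_eq_pow, nsmul_one, ZMod.natCast_zmod_val] at h2

lemma sum_stdAddChar_eq_sum_nthRoots (m : ℕ) [NeZero m] (F : ℂ → ℂ) :
    ∑ j : ZMod m, F (ZMod.stdAddChar j) = ∑ ω ∈ Polynomial.nthRootsFinset m (1 : ℂ), F ω := by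
  have himg : Finset.univ.image (fun j : ZMod m => (ZMod.stdAddChar j : ℂ)) =
      Polynomial.nthRootsFinset m (1 : ℂ) := by
    refine Finset.eq_of_subset_of_card_le ?_ ?_
    · intro z hz
      obtain ⟨j, -, rfl⟩ := Finset.mem_image.mp hz
      rw [Polynomial.mem_nthRootsFinset (NeZero.pos m), ← AddChar.map_nsmul_eq_pow, nsmul_eq_mul]
      simp
    · rw [Finset.card_image_of_injective _ ZMod.injective_stdAddChar, Finset.card_univ, ZMod.card,
        (Complex.isPrimitiveRoot_exp m (NeZero.ne m)).card_nthRootsFinset]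
  rw [← himg, Finset.sum_image ZMod.injective_stdAddChar.injOn]

lemma card_filter_isUnit (m : ℕ) [NeZero m] :
    (Finset.univ.filter fun j : ZMod m => IsUnit j).card = m.totient := by
  rw [← ZMod.card_units_eq_totient, ← Finset.card_univ]
  symm
  refine Finset.card_bij (fun u _ => (u : ZMod m)) (fun u _ => by simp)
    (fun u _ v _ h => Units.ext h) fun j hj => ?_
  obtain ⟨u, rfl⟩ := (Finset.mem_filter.mp hj).2
  exact ⟨u, Finset.mem_univ _, rfl⟩

lemma sum_isUnit_stdAddChar_eq_sum_primitiveRoots (m : ℕ) [NeZero m] (F : ℂ → ℂ) :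
    ∑ j : ZMod m with IsUnit j, F (ZMod.stdAddChar j) = ∑ ω ∈ primitiveRoots m ℂ, F ω := by
  have himg : (Finset.univ.filter fun j : ZMod m => IsUnit j).image
      (fun j : ZMod m => (ZMod.stdAddChar j : ℂ)) = primitiveRoots m ℂ := by
    refine Finset.eq_of_subset_of_card_le ?_ ?_
    · intro z hz
      obtain ⟨j, hj, rfl⟩ := Finset.mem_image.mp hz
      rw [mem_primitiveRoots (NeZero.pos m)]
      exact isPrimitiveRoot_stdAddChar (Finset.mem_filter.mp hj).2
    · rw [Finset.card_image_of_injective _ ZMod.injective_stdAddChar, card_filter_isUnit,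
        Complex.card_primitiveRoots]
  rw [← himg, Finset.sum_image ZMod.injective_stdAddChar.injOn]

lemma sum_primitiveRoots_eq_sum_moebius {m : ℕ} (hm : 0 < m) (F : ℂ → ℂ) :
    ∑ ω ∈ primitiveRoots m ℂ, F ω = ∑ x ∈ m.divisorsAntidiagonal,
      (ArithmeticFunction.moebius x.1 : ℂ) * ∑ ω ∈ Polynomial.nthRootsFinset x.2 (1 : ℂ), F ω := by
  refine ((ArithmeticFunction.sum_eq_iff_sum_mul_moebius_eq
    (f := fun m => ∑ ω ∈ primitiveRoots m ℂ, F ω)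
    (g := fun m => ∑ ω ∈ Polynomial.nthRootsFinset m (1 : ℂ), F ω)).mp ?_ m hm).symm
  intro k _
  rw [IsPrimitiveRoot.nthRoots_one_eq_biUnion_primitiveRoots, Finset.sum_biUnion]
  intro a _ b _ hab
  exact IsPrimitiveRoot.disjoint hab

lemma sum_moebius_div_pow {m : ℕ} (hm : m ≠ 0) (k : ℕ) :
    ∑ d ∈ m.divisors, (ArithmeticFunction.moebius d : ℂ) * (1 / (d : ℂ) ^ k) =
      ∏ p ∈ m.primeFactors, (1 - 1 / (p : ℂ) ^ k) := by
  set r := ∏ p ∈ m.primeFactors, p with hr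
  have hrp : r.primeFactors = m.primeFactors :=
    Nat.primeFactors_prod fun p hp => Nat.prime_of_mem_primeFactors hp
  have hr0 : r ≠ 0 := Finset.prod_ne_zero_iff.mpr fun p hp =>
    (Nat.prime_of_mem_primeFactors hp).ne_zero
  have hrm : r ∣ m := Nat.prod_primeFactors_dvd m
  have hrs : Squarefree r := by
    refine Finset.squarefree_prod_of_pairwise_isCoprime (fun p hp q hq hpq => ?_)
      fun p hp => (Nat.prime_of_mem_primeFactors hp).squarefree
    simp only [Function.onFun, ← Nat.coprime_iff_isRelPrime]
    exact (Nat.coprime_primes (Nat.prime_of_mem_primeFactors hp)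
      (Nat.prime_of_mem_primeFactors hq)).mpr hpq
  set g : ArithmeticFunction ℂ := ⟨fun d => if d = 0 then 0 else 1 / (d : ℂ) ^ k, by simp⟩ with hg
  have hgm : g.IsMultiplicative := by
    refine ArithmeticFunction.IsMultiplicative.iff_ne_zero.mpr ⟨by simp [hg], ?_⟩
    intro a b ha hb _
    simp [hg, ha, hb, mul_pow, mul_comm]
  have h1 := hgm.prodPrimeFactors_one_sub_of_squarefree g hrs
  rw [hrp] at h1
  have hgp : ∀ d : ℕ, d ≠ 0 → g d = 1 / (d : ℂ) ^ k := fun d hd => by simp [hg, hd]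
  rw [Finset.prod_congr rfl fun p hp => by
    rw [hgp p (Nat.prime_of_mem_primeFactors hp).ne_zero]] at h1
  rw [h1]
  symm
  refine (Finset.sum_subset (Nat.divisors_subset_of_dvd hm hrm) ?_).trans ?_
  · intro d hd hdr
    by_cases hsq : Squarefree d
    · refine absurd (Nat.mem_divisors.mpr ⟨?_, hr0⟩) hdr
      rw [← Nat.prod_primeFactors_of_squarefree hsq]
      exact Finset.prod_dvd_prod_of_subset _ _ _
        (Nat.primeFactors_mono (Nat.dvd_of_mem_divisors hd) hm)
    · rw [ArithmeticFunction.moebius_eq_zero_of_not_squarefree hsq]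
      simp
  · exact Finset.sum_congr rfl fun d hd => by rw [hgp d (Nat.pos_of_mem_divisors hd).ne']

lemma sum_moebius_mul_pow {m : ℕ} (hm : m ≠ 0) (k : ℕ) :
    ∑ x ∈ m.divisorsAntidiagonal, (ArithmeticFunction.moebius x.1 : ℂ) * (x.2 : ℂ) ^ k =
      (m : ℂ) ^ k * ∏ p ∈ m.primeFactors, (1 - 1 / (p : ℂ) ^ k) := by
  rw [← sum_moebius_div_pow hm, Finset.mul_sum,
    Nat.sum_divisorsAntidiagonal (fun a b => (ArithmeticFunction.moebius a : ℂ) * (b : ℂ) ^ k)]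
  refine Finset.sum_congr rfl fun d hd => ?_
  have hd0 : (d : ℂ) ≠ 0 := by exact_mod_cast (Nat.pos_of_mem_divisors hd).ne'
  rw [Nat.cast_div (Nat.dvd_of_mem_divisors hd) hd0, div_pow]
  ring

lemma conj_stdAddChar_ratio {m : ℕ} [NeZero m] (j : ZMod m) :
    (starRingEnd ℂ) (((ZMod.stdAddChar j : ℂ) + 1) / (ZMod.stdAddChar j - 1)) =
      -(((ZMod.stdAddChar j : ℂ) + 1) / (ZMod.stdAddChar j - 1)) := by
  set z : ℂ := ZMod.stdAddChar j with hz
  have hc : (starRingEnd ℂ) z = z⁻¹ := by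
    rw [hz, ← AddChar.map_neg_eq_conj, AddChar.map_neg_eq_inv]
  have hz0 : z ≠ 0 := (ZMod.stdAddChar.val_isUnit j).ne_zero
  rw [map_div₀, map_add, map_sub, map_one, hc]
  rcases eq_or_ne z 1 with h | h
  · simp [h]
  · have h1 : z - 1 ≠ 0 := sub_ne_zero.mpr h
    have h2 : 1 - z ≠ 0 := sub_ne_zero.mpr h.symm
    have h3 : z⁻¹ - 1 ≠ 0 := by
      rw [sub_ne_zero]; simpa using h
    field_simp
    ring

lemma stdAddChar_ratio_neg {m : ℕ} [NeZero m] (j : ZMod m) :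
    ((ZMod.stdAddChar (-j) : ℂ) + 1) / (ZMod.stdAddChar (-j) - 1) =
      -(((ZMod.stdAddChar j : ℂ) + 1) / (ZMod.stdAddChar j - 1)) := by
  rw [← conj_stdAddChar_ratio, map_div₀, map_add, map_sub, map_one, AddChar.map_neg_eq_conj]

lemma DirichletCharacter.LFunction_one_of_odd {f : ℕ} [NeZero f] {χ : DirichletCharacter ℂ f}
    (hχ : χ (-1) = -1) :
    χ.LFunction 1 = Complex.I * π / (2 * f) *
      ∑ j, χ j * ((ZMod.stdAddChar j + 1) / (ZMod.stdAddChar j - 1)) :=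
  ZMod_LFunction_one_of_odd (DirichletCharacter.Odd.to_fun hχ)

lemma DirichletCharacter.conj_LFunction_one_of_odd {f : ℕ} [NeZero f] {χ : DirichletCharacter ℂ f}
    (hχ : χ (-1) = -1) :
    (starRingEnd ℂ) (χ.LFunction 1) = Complex.I * π / (2 * f) *
      ∑ j, (starRingEnd ℂ) (χ j) * ((ZMod.stdAddChar j + 1) / (ZMod.stdAddChar j - 1)) := by
  rw [DirichletCharacter.LFunction_one_of_odd hχ, map_mul, map_sum]
  simp only [map_mul (starRingEnd ℂ) (χ _) _, conj_stdAddChar_ratio, mul_neg,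
    Finset.sum_neg_distrib]
  simp only [map_mul, map_div₀, Complex.conj_I, Complex.conj_ofReal, Complex.conj_natCast,
    Complex.conj_ofNat]
  ring

lemma DirichletCharacter.sum_odd_mul_conj {f : ℕ} [NeZero f] (a : ZMod f) {b : ZMod f}
    (hb : IsUnit b) :
    ∑ χ : DirichletCharacter ℂ f with χ (-1) = -1, χ a * (starRingEnd ℂ) (χ b) =
      (f.totient : ℂ) / 2 * ((if b = a then 1 else 0) - (if -b = a then 1 else 0)) := by
  have hstar : ∀ χ : DirichletCharacter ℂ f, (starRingEnd ℂ) (χ b) = χ b⁻¹ := by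
    intro χ
    rw [starRingEnd_apply, MulChar.star_apply', MulChar.inv_apply_eq_inv']
    refine (eq_inv_of_mul_eq_one_left ?_).symm
    rw [← map_mul, ZMod.inv_mul_of_unit b hb, map_one]
  have h1 := DirichletCharacter.sum_char_inv_mul_char_eq ℂ hb a
  have h2 := DirichletCharacter.sum_char_inv_mul_char_eq ℂ hb.neg a
  have hnegb : (-b)⁻¹ = -b⁻¹ := by
    obtain ⟨u, rfl⟩ := hb
    rw [← Units.val_neg, ZMod.inv_coe_unit, ZMod.inv_coe_unit, inv_neg, Units.val_neg]
  calc ∑ χ : DirichletCharacter ℂ f with χ (-1) = -1, χ a * (starRingEnd ℂ) (χ b)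
      = ∑ χ : DirichletCharacter ℂ f, (χ b⁻¹ * χ a - χ (-b)⁻¹ * χ a) / 2 := by
        rw [Finset.sum_filter]
        refine Finset.sum_congr rfl fun χ _ => ?_
        rw [hstar, hnegb, ← neg_one_mul b⁻¹, map_mul]
        rcases χ.even_or_odd with h | h
        · rw [DirichletCharacter.Even] at h
          rw [h, if_neg (by norm_num)]
          ring
        · rw [DirichletCharacter.Odd] at h
          rw [h, if_pos rfl]
          ring
    _ = _ := by
        rw [← Finset.sum_div, Finset.sum_sub_distrib, h1, h2]
        split_ifs <;> ring

lemma DirichletCharacter.sum_odd_mul_stdAddChar_ratio {f : ℕ} [NeZero f] (b : ZMod f) :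
    ∑ χ : DirichletCharacter ℂ f with χ (-1) = -1,
      (∑ a, χ a * ((ZMod.stdAddChar a + 1) / (ZMod.stdAddChar a - 1))) * (starRingEnd ℂ) (χ b) =
      if IsUnit b then (f.totient : ℂ) * ((ZMod.stdAddChar b + 1) / (ZMod.stdAddChar b - 1))
      else 0 := by
  split_ifs with hb
  · have : ∀ χ : DirichletCharacter ℂ f,
        (∑ a, χ a * ((ZMod.stdAddChar a + 1) / (ZMod.stdAddChar a - 1))) * (starRingEnd ℂ) (χ b) =
        ∑ a, χ a * (starRingEnd ℂ) (χ b) *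
          ((ZMod.stdAddChar a + 1) / (ZMod.stdAddChar a - 1)) := fun χ => by
      rw [Finset.sum_mul]
      exact Finset.sum_congr rfl fun a _ => by ring
    simp_rw [this]
    rw [Finset.sum_comm]
    simp_rw [← Finset.sum_mul, DirichletCharacter.sum_odd_mul_conj _ hb, mul_assoc,
      ← Finset.mul_sum, sub_mul, Finset.sum_sub_distrib, ite_mul, one_mul, zero_mul]
    rw [Finset.sum_ite_eq, Finset.sum_ite_eq, if_pos (Finset.mem_univ _),
      if_pos (Finset.mem_univ _), stdAddChar_ratio_neg]
    ring
  · refine Finset.sum_eq_zero fun χ _ => ?_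
    rw [χ.map_nonunit hb]
    simp

lemma DirichletCharacter.prod_apply {f : ℕ} {ι : Type*} {s : Finset ι} (hs : s.Nonempty)
    (χ : ι → DirichletCharacter ℂ f) (a : ZMod f) : (∏ i ∈ s, χ i) a = ∏ i ∈ s, χ i a := by
  induction hs using Finset.Nonempty.cons_induction with
  | singleton i => simp
  | cons i s hi _ ih => rw [Finset.prod_cons, Finset.prod_cons, MulChar.mul_apply, ih]

lemma sum_odd_prod_LFunction_one {f N : ℕ} [NeZero f] (hN : Odd N) :
    ∑ χ : Fin N → DirichletCharacter ℂ f with ∀ i, χ i (-1) = -1,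
        (∏ i, (χ i).LFunction 1) *
          (starRingEnd ℂ) (DirichletCharacter.LFunction (∏ i, χ i) 1) =
      (Complex.I * π / (2 * f)) ^ (N + 1) * (f.totient : ℂ) ^ N *
        ∑ b : ZMod f with IsUnit b,
          (((ZMod.stdAddChar b : ℂ) + 1) / (ZMod.stdAddChar b - 1)) ^ (N + 1) := by
  set y : ZMod f → ℂ := fun a => (ZMod.stdAddChar a + 1) / (ZMod.stdAddChar a - 1) with hy
  have hN0 : N ≠ 0 := hN.pos.ne'
  have happ : ∀ (χ : Fin N → DirichletCharacter ℂ f) (a : ZMod f),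
      (∏ i, χ i) a = ∏ i, χ i a := by
    intro χ a
    have := Fin.pos_iff_nonempty.mp hN.pos
    exact DirichletCharacter.prod_apply Finset.univ_nonempty χ a
  have hterm : ∀ χ : Fin N → DirichletCharacter ℂ f, (∀ i, χ i (-1) = -1) →
      (∏ i, (χ i).LFunction 1) *
          (starRingEnd ℂ) (DirichletCharacter.LFunction (∏ i, χ i) 1) =
        (Complex.I * π / (2 * f)) ^ (N + 1) *
          ∑ b, y b * ∏ i, ((∑ a, χ i a * y a) * (starRingEnd ℂ) (χ i b)) := by
    intro χ hχ
    have hodd : (∏ i, χ i) (-1) = -1 := by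
      rw [happ, Finset.prod_congr rfl fun i _ => hχ i]
      simp [hN.neg_one_pow]
    rw [DirichletCharacter.conj_LFunction_one_of_odd hodd,
      Finset.prod_congr rfl fun i _ => DirichletCharacter.LFunction_one_of_odd (hχ i),
      Finset.prod_mul_distrib, Finset.prod_const, Finset.card_univ, Fintype.card_fin]
    simp_rw [Finset.prod_mul_distrib, happ, map_prod]
    rw [pow_succ, mul_mul_mul_comm, Finset.mul_sum]
    congr 1
    exact Finset.sum_congr rfl fun b _ => by ring
  rw [Finset.sum_congr rfl fun χ hχ => hterm χ (Finset.mem_filter.mp hχ).2, ← Finset.mul_sum,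
    Finset.sum_comm, mul_assoc]
  congr 1
  have hpi : (Finset.univ.filter fun χ : Fin N → DirichletCharacter ℂ f => ∀ i, χ i (-1) = -1) =
      Fintype.piFinset fun _ => Finset.univ.filter fun χ : DirichletCharacter ℂ f =>
        χ (-1) = -1 := by
    ext χ
    simp
  simp_rw [← Finset.mul_sum, hpi]
  rw [Finset.mul_sum, Finset.sum_filter]
  refine Finset.sum_congr rfl fun b _ => ?_
  rw [← Finset.prod_univ_sum (fun _ : Fin N => Finset.univ.filter
      fun χ : DirichletCharacter ℂ f => χ (-1) = -1)
      (fun _ χ => (∑ a, χ a * y a) * (starRingEnd ℂ) (χ b)),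
    DirichletCharacter.sum_odd_mul_stdAddChar_ratio, Finset.prod_const, Finset.card_univ,
    Fintype.card_fin]
  split_ifs
  · rw [mul_pow]
    ring
  · simp [hN0]

lemma coeff_cothSeries_pow_mul_rescale {n k : ℕ} (hk : k ≤ n) (z : ℂ) :
    PowerSeries.coeff (2 * k) (cothSeries ^ n * PowerSeries.rescale z cothSeries) =
      ∑ j ∈ Finset.range (k + 1), z ^ (2 * j) *
        ((bernoulli (2 * j) : ℂ) / ((2 * j).factorial : ℂ)) * (bernC n (k - j) : ℂ) := by
  rw [mul_comm (cothSeries ^ n), PowerSeries.coeff_mul, Finset.Nat.sum_antidiagonal_eq_sum_range_succ_mk]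
  simp only [PowerSeries.coeff_rescale]
  have hinj : Set.InjOn (fun j => 2 * j) (Finset.range (k + 1) : Set ℕ) :=
    fun a _ b _ h => by simpa using h
  have hsub : (Finset.range (k + 1)).image (fun j => 2 * j) ⊆ Finset.range (2 * k).succ := by
    intro i hi
    simp only [Finset.mem_image, Finset.mem_range] at hi ⊢
    omega
  rw [← Finset.sum_subset hsub, Finset.sum_image hinj]
  · refine Finset.sum_congr rfl fun j hj => ?_
    have hj' : j ≤ k := Nat.lt_succ_iff.mp (Finset.mem_range.mp hj)
    rw [coeff_cothSeries_even, ← Nat.mul_sub, coeff_cothSeries_pow (by omega)]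
  · intro i _ hi
    rcases Nat.even_or_odd' i with ⟨j, rfl | rfl⟩
    · refine absurd (Finset.mem_image_of_mem _ (Finset.mem_range.mpr ?_)) hi
      simp only [Finset.mem_range] at *
      omega
    · rw [coeff_cothSeries_odd]
      ring

lemma sum_isUnit_stdAddChar_ratio_pow {f k : ℕ} [NeZero f] (hk : k ≠ 0) :
    ∑ b : ZMod f with IsUnit b,
        (((ZMod.stdAddChar b : ℂ) + 1) / (ZMod.stdAddChar b - 1)) ^ (2 * k) =
      f * ∏ p ∈ f.primeFactors, (1 - 1 / (p : ℂ)) - 2 ^ (2 * k) *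
        ∑ j ∈ Finset.range (k + 1), (f : ℂ) ^ (2 * j) *
          (∏ p ∈ f.primeFactors, (1 - 1 / (p : ℂ) ^ (2 * j))) *
          ((bernoulli (2 * j) : ℂ) / ((2 * j).factorial : ℂ)) * (bernC (2 * k) (k - j) : ℂ) := by
  rw [sum_isUnit_stdAddChar_eq_sum_primitiveRoots f fun z => ((z + 1) / (z - 1)) ^ (2 * k),
    sum_primitiveRoots_eq_sum_moebius (NeZero.pos f)]
  have hS : ∀ x ∈ f.divisorsAntidiagonal, (ArithmeticFunction.moebius x.1 : ℂ) *
      ∑ ω ∈ Polynomial.nthRootsFinset x.2 (1 : ℂ), ((ω + 1) / (ω - 1)) ^ (2 * k) =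
      (ArithmeticFunction.moebius x.1 : ℂ) * (x.2 : ℂ) ^ 1 - 2 ^ (2 * k) *
        ∑ j ∈ Finset.range (k + 1), (ArithmeticFunction.moebius x.1 : ℂ) * (x.2 : ℂ) ^ (2 * j) *
          ((bernoulli (2 * j) : ℂ) / ((2 * j).factorial : ℂ)) *
            (bernC (2 * k) (k - j) : ℂ) := by
    intro x hx
    have : NeZero x.2 := ⟨right_ne_zero_of_mul
      ((Nat.mem_divisorsAntidiagonal.mp hx).1 ▸ NeZero.ne f)⟩
    rw [← sum_stdAddChar_eq_sum_nthRoots x.2 fun z => ((z + 1) / (z - 1)) ^ (2 * k),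
      sum_stdAddChar_ratio_pow (even_two_mul k) (by omega),
      coeff_cothSeries_pow_mul_rescale (by omega), mul_sub, pow_one, mul_left_comm,
      Finset.mul_sum]
    simp only [mul_assoc]
  rw [Finset.sum_congr rfl hS, Finset.sum_sub_distrib, sum_moebius_mul_pow (NeZero.ne f),
    ← Finset.mul_sum, Finset.sum_comm]
  simp_rw [← Finset.sum_mul, sum_moebius_mul_pow (NeZero.ne f), pow_one]

lemma bernC_zero (n : ℕ) : bernC n 0 = 1 := by
  simp [bernC, Nat.factorial_ne_zero]

lemma sum_range_eq_add_sum_Icc {k : ℕ} (hk : k ≠ 0) (g : ℕ → ℂ) :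
    ∑ j ∈ Finset.range (k + 1), g j = g 0 + ∑ j ∈ Finset.Icc 1 (k - 1), g j + g k := by
  obtain ⟨m, rfl⟩ := Nat.exists_eq_succ_of_ne_zero hk
  rw [Finset.sum_range_succ, Finset.sum_range_succ', Nat.succ_eq_add_one, Nat.add_sub_cancel,
    add_comm (g 0), Finset.range_eq_Ico, Finset.sum_Ico_add' g 0 m 1]
  rfl

/-- **Mean value of products of `n` values `L(1,·)` at odd characters:**
for even `n ≥ 2` and `f > 2`,
`M_n(f) = (2/φ(f))^{n-1} ∑_{χ₁,…,χ_{n-1} odd} L(1,χ₁)⋯L(1,χ_{n-1})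
  conj(L(1,χ₁⋯χ_{n-1}))`
equals
`ζ(n)(φ_n(f) + (n!/B_n) ∑_{k₀=1}^{n/2-1} C_{n,n/2-k₀} (B_{2k₀}/(2k₀)!)
  φ_{2k₀}(f)/f^{n-2k₀}) + (-1)^{n/2} π^n φ₁(f)/(2 f^{n-1})`. -/
theorem mean_value_product_L_one (n f : ℕ) (hn : 2 ≤ n) (hpar : Even n)
    [NeZero f] (hf : 2 < f) :
    (2 / (Nat.totient f : ℂ)) ^ (n - 1) *
      ∑ χ ∈ Finset.univ.filter
          (fun χ : Fin (n - 1) → DirichletCharacter ℂ f =>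
            ∀ i, χ i (-1) = -1),
        (∏ i, (χ i).LFunction 1) *
          (starRingEnd ℂ) (DirichletCharacter.LFunction (∏ i, χ i) 1)
    = riemannZeta n *
        ((∏ p ∈ f.primeFactors, (1 - 1 / (p : ℂ) ^ n))
          + ((Nat.factorial n : ℂ) / (bernoulli n : ℂ)) *
            ∑ k₀ ∈ Finset.Icc 1 (n / 2 - 1),
              (bernC n (n / 2 - k₀) : ℂ) *
                ((bernoulli (2 * k₀) : ℂ) / (Nat.factorial (2 * k₀) : ℂ)) *
                (∏ p ∈ f.primeFactors, (1 - 1 / (p : ℂ) ^ (2 * k₀))) /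
                  (f : ℂ) ^ (n - 2 * k₀))
      + (-1) ^ (n / 2) * (π : ℂ) ^ n *
          (∏ p ∈ f.primeFactors, (1 - 1 / (p : ℂ))) / (2 * (f : ℂ) ^ (n - 1)) := by
  have hodd : Odd (n - 1) := Nat.Even.sub_odd (by omega) hpar odd_one
  obtain ⟨k, rfl⟩ := hpar.exists_two_nsmul
  rw [smul_eq_mul] at *
  have hk : k ≠ 0 := by omega
  have hf0 : (f : ℂ) ≠ 0 := NeZero.ne _
  have htot : (f.totient : ℂ) ≠ 0 := by
    exact_mod_cast (Nat.totient_pos.mpr (NeZero.pos f)).ne'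
  have hprime : ∏ p ∈ f.primeFactors, (1 - 1 / (p : ℂ) ^ (2 * 0)) = 0 := by
    refine Finset.prod_eq_zero (Nat.mem_primeFactors.mpr
      ⟨Nat.minFac_prime (by omega), Nat.minFac_dvd f, by omega⟩) ?_
    simp
  have hzeta : riemannZeta ((2 * k : ℕ) : ℂ) = (-1) ^ (k + 1) * 2 ^ (2 * k - 1) * π ^ (2 * k) *
      ((bernoulli (2 * k) : ℂ) / ((2 * k).factorial : ℂ)) := by
    rw [Nat.cast_mul, Nat.cast_ofNat, riemannZeta_two_mul_nat hk, mul_div_assoc]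
  have hbern : (bernoulli (2 * k) : ℂ) ≠ 0 := by
    intro h
    refine riemannZeta_ne_zero_of_one_lt_re (s := ((2 * k : ℕ) : ℂ)) ?_ (by rw [hzeta, h]; simp)
    rw [Complex.natCast_re]
    exact_mod_cast hn
  have hfac : ((2 * k).factorial : ℂ) ≠ 0 := by exact_mod_cast Nat.factorial_ne_zero _
  have hI : Complex.I ^ (2 * k) = (-1) ^ k := by rw [pow_mul, Complex.I_sq]
  rw [sum_odd_prod_LFunction_one hodd, Nat.sub_add_cancel (by omega),
    sum_isUnit_stdAddChar_ratio_pow hk, sum_range_eq_add_sum_Icc hk, hprime, Nat.sub_self,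
    bernC_zero, Nat.mul_div_cancel_left k two_pos, hzeta]
  have hsum : ∑ j ∈ Finset.Icc 1 (k - 1), (f : ℂ) ^ (2 * j) *
          (∏ p ∈ f.primeFactors, (1 - 1 / (p : ℂ) ^ (2 * j))) *
          ((bernoulli (2 * j) : ℂ) / ((2 * j).factorial : ℂ)) * (bernC (2 * k) (k - j) : ℂ) =
      (f : ℂ) ^ (2 * k) * ∑ k₀ ∈ Finset.Icc 1 (k - 1),
              (bernC (2 * k) (k - k₀) : ℂ) *
                ((bernoulli (2 * k₀) : ℂ) / (Nat.factorial (2 * k₀) : ℂ)) *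
                (∏ p ∈ f.primeFactors, (1 - 1 / (p : ℂ) ^ (2 * k₀))) /
                  (f : ℂ) ^ (2 * k - 2 * k₀) := by
    rw [Finset.mul_sum]
    refine Finset.sum_congr rfl fun j hj => ?_
    have hjk : 2 * j ≤ 2 * k := by
      have := (Finset.mem_Icc.mp hj).2
      omega
    rw [← pow_sub_mul_pow (f : ℂ) hjk]
    field_simp
  rw [hsum]
  obtain ⟨m, rfl⟩ : ∃ m, k = m + 1 := Nat.exists_eq_succ_of_ne_zero hk
  rw [div_pow, div_pow, mul_pow, mul_pow, hI, show 2 * (m + 1) - 1 = 2 * m + 1 by omega]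
  generalize ∑ k₀ ∈ Finset.Icc 1 (m + 1 - 1), _ / (f : ℂ) ^ (2 * (m + 1) - 2 * k₀) = T
  generalize ∏ p ∈ f.primeFactors, (1 - 1 / (p : ℂ) ^ (2 * (m + 1))) = P
  generalize ∏ p ∈ f.primeFactors, (1 - 1 / (p : ℂ)) = Q
  field_simp
  push_cast
  ring
end
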